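/- arXiv:2303.08712 — 2 statements merged into one kernel-verified Lean document; each statement's English description precedes it below -/
import Mathlib

section
/- Let Γ be a finite abelian group of order n with exactly one involution ι_Γ, and let r_1, r_2, …, r_t be integers with r_1 + r_2 + … + r_t = n − 2 and r_i ≥ 4 for all 1 ≤ i ≤ t. Then there exist pairwise disjoint zero-sum subsets A_1, A_2, …, A_t of Γ \ {0, ι_Γ} such that |A_i| = r_i for all 1 ≤ i ≤ t. -/
open Finset

/-- A family of zero-sum triples whose entries and their negatives are all pairwise distinct. -/
def IsTripleSystem {I G : Type*} [AddCommGroup G] (f : I → Fin 3 → G) : Prop :=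
  (∀ i, f i 0 + f i 1 + f i 2 = 0) ∧
  (∀ i j i' j', f i j = f i' j' → i = i' ∧ j = j') ∧
  ∀ i j i' j', f i j ≠ -f i' j'

namespace IsTripleSystem

variable {I J G Q : Type*} [AddCommGroup G] [AddCommGroup Q]

theorem comp_injective {f : I → Fin 3 → G} (hf : IsTripleSystem f) {g : J → I}
    (hg : Function.Injective g) : IsTripleSystem (fun i => f (g i)) :=
  ⟨fun _ => hf.1 _, fun _ _ _ _ h => ⟨hg (hf.2.1 _ _ _ _ h).1, (hf.2.1 _ _ _ _ h).2⟩,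
    fun _ _ _ _ => hf.2.2 _ _ _ _⟩

theorem map_injective {f : I → Fin 3 → Q} (hf : IsTripleSystem f) (φ : Q →+ G)
    (hφ : Function.Injective φ) : IsTripleSystem (fun i j => φ (f i j)) :=
  ⟨fun i => by rw [← map_add, ← map_add, hf.1, map_zero],
    fun _ _ _ _ h => hf.2.1 _ _ _ _ (hφ h),
    fun i j i' j' h => hf.2.2 i j i' j' (hφ (by rw [map_neg]; exact h))⟩

/-- A triple system of a quotient by a subgroup of odd order lifts to the whole group. -/
theorem exists_lift {f : I → Fin 3 → Q} (hf : IsTripleSystem f) (φ : G →+ Q)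
    (hφ : Function.Surjective φ) (hker : ∀ x, φ x = 0 → x + x = 0 → x = 0) :
    ∃ g : I × φ.ker → Fin 3 → G, IsTripleSystem g := by
  choose σ hσ using hφ
  let g : I × φ.ker → Fin 3 → G := fun u =>
    ![σ (f u.1 0) + u.2, σ (f u.1 1) + u.2, -(σ (f u.1 0) + σ (f u.1 1)) - u.2 - u.2]
  have hk : ∀ k : φ.ker, φ k = 0 := fun k => k.2
  have hg : ∀ u j, φ (g u j) = f u.1 j := by
    intro u j
    have h0 := hf.1 u.1
    fin_cases j
    · simp [g, hσ, hk]
    · simp [g, hσ, hk]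
    · simp only [g, Fin.reduceFinMk, Matrix.cons_val, map_sub, map_neg, map_add, hσ, hk, sub_zero]
      exact (eq_neg_of_add_eq_zero_right h0).symm
  refine ⟨g, ?_, ?_, ?_⟩
  · intro u
    simp only [g, Matrix.cons_val]
    abel
  · rintro ⟨i, k⟩ j ⟨i', k'⟩ j' h
    obtain ⟨rfl, rfl⟩ : i = i' ∧ j = j' := by
      apply hf.2.1
      rw [← hg (i, k), ← hg (i', k'), h]
    refine ⟨?_, rfl⟩
    congr 1
    apply Subtype.ext
    fin_cases j
    · simpa [g] using h
    · simpa [g] using h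
    · rw [← sub_eq_zero]
      apply hker
      · simp [hk]
      · simp only [g, Fin.reduceFinMk, Matrix.cons_val, sub_sub] at h
        have h2 := sub_right_injective h
        have h3 : (k : G) + k = k' + k' := h2
        calc (k : G) - k' + (k - k') = (k + k) - (k' + k') := by abel
          _ = 0 := by rw [h3, sub_self]
  · intro u j u' j' h
    apply hf.2.2 u.1 j u'.1 j'
    rw [← hg u, ← hg u', h, map_neg]

end IsTripleSystem

theorem exists_isTripleSystem_zmod (M s : ℕ) (h : 6 * s + 4 ≤ M) :
    ∃ f : Fin s → Fin 3 → ZMod M, IsTripleSystem f := by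
  -- The differences `1, …, s`, realised by nested pairs around one centre for each parity.
  let x : ℕ → ℤ := fun d =>
    if d % 2 = 1 then s + ((s + 1) / 2 : ℕ) - (d / 2 : ℕ) else
      s + 2 * ((s + 1) / 2 : ℕ) + (s / 2 : ℕ) + 1 - (d / 2 : ℕ)
  let F : Fin s → Fin 3 → ℤ := fun i => ![(i : ℤ) + 1, x (i + 1), -(x (i + 1) + (i + 1))]
  have hF : ∀ i j, F i j ≠ 0 ∧ 2 * |F i j| < M := by
    intro i j
    have hi := i.2
    have hs : (s + 1) / 2 + s / 2 = s := by omega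
    have hd : (i + 1 : ℕ) / 2 ≤ s / 2 := Nat.div_le_div_right hi
    fin_cases j <;> simp only [F, x, Fin.zero_eta, Fin.mk_one, Fin.reduceFinMk, Matrix.cons_val,
      abs_neg] <;> (try split_ifs) <;> constructor <;> try rw [abs_of_nonneg (by omega)]
    all_goals omega
  have hinj : ∀ i j i' j', |F i j| = |F i' j'| → i = i' ∧ j = j' := by
    intro i j i' j'
    have hi := i.2
    have hi' := i'.2
    rw [Fin.ext_iff]
    fin_cases j <;> fin_cases j' <;> simp only [F, x, Fin.zero_eta, Fin.mk_one, Fin.reduceFinMk,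
      Matrix.cons_val, abs_neg] <;> (try split_ifs) <;> intro h <;>
      rw [abs_of_nonneg (by omega), abs_of_nonneg (by omega)] at h
    all_goals simp only [Fin.isValue, Fin.reduceEq, and_true, and_false]; omega
  refine ⟨fun i j => (F i j : ZMod M), ?_, ?_, ?_⟩
  · intro i
    simp only [F, Matrix.cons_val]
    push_cast
    ring
  · intro i j i' j' h
    apply hinj
    have h2 := (ZMod.intCast_eq_intCast_iff_dvd_sub _ _ _).1 h
    have h3 := Int.eq_zero_of_abs_lt_dvd h2 (by
      have := abs_sub (F i' j') (F i j)
      linarith [(hF i j).2, (hF i' j').2])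
    rw [sub_eq_zero.1 h3]
  · intro i j i' j' h
    rw [← Int.cast_neg] at h
    have h2 := (ZMod.intCast_eq_intCast_iff_dvd_sub _ _ _).1 h
    have h3 := Int.eq_zero_of_abs_lt_dvd h2 (by
      have := abs_sub (-F i' j') (F i j)
      rw [abs_neg] at this
      linarith [(hF i j).2, (hF i' j').2])
    have h4 : -F i' j' = F i j := sub_eq_zero.1 h3
    obtain ⟨rfl, rfl⟩ := hinj i j i' j' (by rw [← h4, abs_neg])
    exact (hF i j).1 (by omega)

theorem exists_isTripleSystem_zmod_six :
    ∃ f : Fin 2 → Fin 3 → ZMod 6 × ZMod 3, IsTripleSystem f :=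
  ⟨![![(1, 2), (3, 1), (2, 0)], ![(2, 1), (4, 1), (0, 1)]], by unfold IsTripleSystem; decide⟩

set_option maxRecDepth 10000 in
theorem exists_isTripleSystem_zmod_twelve :
    ∃ f : Fin 4 → Fin 3 → ZMod 12 × ZMod 3, IsTripleSystem f :=
  ⟨![![(1, 2), (2, 1), (9, 0)], ![(6, 1), (7, 0), (11, 2)], ![(1, 0), (4, 1), (7, 2)],
    ![(2, 0), (0, 2), (10, 1)]], by unfold IsTripleSystem; decide⟩

set_option maxRecDepth 10000 in
theorem exists_isTripleSystem_zmod_fourteen :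
    ∃ f : Fin 10 → Fin 3 → ZMod 14 × ZMod 7, IsTripleSystem f :=
  ⟨![![(7, 1), (5, 4), (2, 2)], ![(3, 5), (1, 5), (10, 4)], ![(7, 2), (9, 4), (12, 1)],
    ![(0, 3), (5, 2), (9, 2)], ![(4, 0), (4, 4), (6, 3)], ![(6, 6), (6, 1), (2, 0)],
    ![(5, 6), (6, 0), (3, 1)], ![(1, 3), (5, 1), (8, 3)], ![(6, 5), (7, 3), (1, 6)],
    ![(1, 2), (12, 4), (1, 1)]], by unfold IsTripleSystem; decide⟩

/-- A noncyclic group with a unique involution has a quotient `ZMod (2 ^ k * p) × ZMod p` in which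
the involution does not vanish, so that the kernel has odd order. -/
theorem exists_surjective_of_not_isAddCyclic {G : Type*} [AddCommGroup G] [Finite G] (ι : G)
    (hι0 : ι ≠ 0) (hι2 : ι + ι = 0) (hι : ∀ x : G, x ≠ 0 → x + x = 0 → x = ι)
    (hc : ¬ IsAddCyclic G) :
    ∃ k p : ℕ, 0 < k ∧ p.Prime ∧ p ≠ 2 ∧ ∃ φ : G →+ ZMod (2 ^ k * p) × ZMod p,
      Function.Surjective φ ∧ φ ι ≠ 0 := by
  classical
  obtain ⟨I, _, p, hp, e, ⟨f₀⟩⟩ := AddCommGroup.equiv_directSum_zmod_of_finite G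
  let f : G ≃+ ∀ i, ZMod (p i ^ e i) := f₀.trans (DirectSum.addEquivProd _)
  obtain ⟨i₀, hi₀⟩ : ∃ i, f ι i ≠ 0 := by
    by_contra! h
    exact hι0 (f.injective (by rw [map_zero]; exact funext h))
  have two_coord : ∀ i, p i = 2 → 0 < e i → ∃ z : ZMod (p i ^ e i), z ≠ 0 ∧ z + z = 0 := by
    intro i hi he
    rw [hi]
    obtain ⟨d, hd⟩ := Nat.exists_eq_succ_of_ne_zero he.ne'
    refine ⟨((2 ^ d : ℕ) : ZMod (2 ^ e i)), ?_, ?_⟩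
    · rw [Ne, ZMod.natCast_eq_zero_iff, hd, Nat.pow_dvd_pow_iff_le_right (by norm_num)]
      omega
    · rw [← Nat.cast_add, ZMod.natCast_eq_zero_iff, hd, pow_succ, mul_two]
  have two_unique : ∀ i, p i = 2 → 0 < e i → f ι = Pi.single i (f ι i) := by
    intro i hi he
    obtain ⟨z, hz0, hz⟩ := two_coord i hi he
    have h : f.symm (Pi.single i z) = ι := by
      apply hι
      · simpa using hz0
      · rw [← map_add, ← Pi.single_add, hz, Pi.single_zero, map_zero]
    rw [← h]
    simp
  have he₀ : 0 < e i₀ := by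
    by_contra! h
    have h1 : p i₀ ^ e i₀ = 1 := by rw [Nat.le_zero.1 h, pow_zero]
    have : Subsingleton (ZMod (p i₀ ^ e i₀)) := by rw [h1]; infer_instance
    exact hi₀ (Subsingleton.elim _ _)
  have hp₀ : p i₀ = 2 := by
    by_contra h2
    apply hi₀
    have h3 : f ι i₀ + f ι i₀ = 0 := by
      rw [← Pi.add_apply, ← map_add, hι2, map_zero, Pi.zero_apply]
    have hu : IsUnit ((2 : ℕ) : ZMod (p i₀ ^ e i₀)) := by
      rw [ZMod.isUnit_iff_coprime]
      exact Nat.Coprime.pow_right _ ((Nat.coprime_primes Nat.prime_two (hp i₀)).2 (Ne.symm h2))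
    rw [← two_mul] at h3
    exact (hu.mul_right_eq_zero).1 (by exact_mod_cast h3)
  obtain ⟨i, j, hij, hp_eq, hei, hej⟩ : ∃ i j, i ≠ j ∧ p i = p j ∧ 0 < e i ∧ 0 < e j := by
    by_contra! h
    apply hc
    have hcop : Pairwise (Function.onFun Nat.Coprime (fun i => p i ^ e i)) := by
      intro i j hij
      rcases Nat.eq_zero_or_pos (e i) with h1 | h1
      · simp [Function.onFun, h1]
      rcases Nat.eq_zero_or_pos (e j) with h2 | h2
      · simp [Function.onFun, h2]
      refine Nat.Coprime.pow _ _ ((Nat.coprime_primes (hp i) (hp j)).2 fun h3 => ?_)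
      exact h2.ne' (Nat.le_zero.1 (h i j hij h3 h1))
    exact isAddCyclic_of_surjective
      (f.trans (ZMod.prodEquivPi (fun i => p i ^ e i) hcop).symm.toAddEquiv).symm
      (AddEquiv.surjective _)
  have hpi2 : p i ≠ 2 := by
    intro h2
    have h3 := two_unique i h2 hei
    rw [two_unique j (hp_eq ▸ h2) hej] at h3
    have h4 := congrFun h3 j
    rw [Pi.single_eq_same, Pi.single_eq_of_ne hij.symm] at h4
    rw [two_unique j (hp_eq ▸ h2) hej, h4, Pi.single_zero] at h3
    exact hι0 (f.injective (by rw [map_zero, two_unique j (hp_eq ▸ h2) hej, h4, Pi.single_zero]))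
  have hi₀i : i₀ ≠ i := fun h => hpi2 (h ▸ hp₀)
  have hi₀j : i₀ ≠ j := fun h => hpi2 (hp_eq ▸ h ▸ hp₀)
  have hd : 2 ^ e i₀ ∣ p i₀ ^ e i₀ := by rw [hp₀]
  have hdi : p i ∣ p i ^ e i := dvd_pow_self _ hei.ne'
  have hdj : p i ∣ p j ^ e j := hp_eq ▸ dvd_pow_self _ hej.ne'
  have hcop : Nat.Coprime (2 ^ e i₀) (p i) :=
    Nat.Coprime.pow_left _ ((Nat.coprime_primes Nat.prime_two (hp i)).2 (Ne.symm hpi2))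
  let c := ZMod.chineseRemainder hcop
  let ψ : (∀ i, ZMod (p i ^ e i)) →+ ZMod (2 ^ e i₀ * p i) × ZMod (p i) :=
    (c.symm.toAddEquiv.toAddMonoidHom.comp
      (((ZMod.castHom hd (ZMod (2 ^ e i₀))).toAddMonoidHom.comp (Pi.evalAddMonoidHom _ i₀)).prod
        ((ZMod.castHom hdi (ZMod (p i))).toAddMonoidHom.comp (Pi.evalAddMonoidHom _ i)))).prod
      ((ZMod.castHom hdj (ZMod (p i))).toAddMonoidHom.comp (Pi.evalAddMonoidHom _ j))
  have hψ : ∀ v, ψ v = (c.symm (ZMod.castHom hd (ZMod (2 ^ e i₀)) (v i₀),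
      ZMod.castHom hdi (ZMod (p i)) (v i)), ZMod.castHom hdj (ZMod (p i)) (v j)) := fun _ => rfl
  refine ⟨e i₀, p i, he₀, hp i, hpi2, ψ.comp f.toAddMonoidHom, ?_, ?_⟩
  · refine Function.Surjective.comp (g := ψ) ?_ f.surjective
    rintro ⟨a, b⟩
    obtain ⟨x, hx⟩ := ZMod.castHom_surjective hd (c a).1
    obtain ⟨y, hy⟩ := ZMod.castHom_surjective hdi (c a).2
    obtain ⟨z, hz⟩ := ZMod.castHom_surjective hdj b
    refine ⟨Function.update (Function.update (Function.update 0 i₀ x) i y) j z, ?_⟩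
    rw [hψ, Function.update_self, Function.update_of_ne hij, Function.update_self,
      Function.update_of_ne hi₀j, Function.update_of_ne hi₀i, Function.update_self, hx, hy, hz]
    exact Prod.ext (c.symm_apply_apply a) rfl
  · intro h
    have h1 : ψ (f ι) = 0 := h
    rw [hψ] at h1
    have h2 := (map_eq_zero_iff c.symm c.symm.injective).1 (congrArg Prod.fst h1)
    have h3 : ZMod.castHom hd (ZMod (2 ^ e i₀)) (f ι i₀) = 0 := congrArg Prod.fst h2
    apply hi₀
    have hinj : Function.Injective (ZMod.castHom hd (ZMod (2 ^ e i₀))) := by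
      have : NeZero (2 ^ e i₀) := ⟨by positivity⟩
      have : NeZero (p i₀ ^ e i₀) := ⟨pow_ne_zero _ (hp i₀).ne_zero⟩
      refine ((Fintype.bijective_iff_surjective_and_card _).2
        ⟨ZMod.castHom_surjective hd, ?_⟩).1
      rw [ZMod.card, ZMod.card, hp₀]
    exact hinj (by rw [h3, map_zero])

theorem exists_isTripleSystem_of_surjective {G Q : Type*} [AddCommGroup G] [AddCommGroup Q]
    [Finite G] {m s : ℕ} {f : Fin m → Fin 3 → Q} (hf : IsTripleSystem f) (φ : G →+ Q)
    (hφ : Function.Surjective φ) (hker : ∀ x, φ x = 0 → x + x = 0 → x = 0)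
    (hm : Nat.card Q ≤ 10 * m) (hs : 10 * s ≤ Nat.card G) :
    ∃ g : Fin s → Fin 3 → G, IsTripleSystem g := by
  classical
  obtain ⟨g, hg⟩ := hf.exists_lift φ hφ hker
  have hcard : Nat.card G = Nat.card Q * Nat.card φ.ker := by
    rw [AddSubgroup.card_eq_card_quotient_mul_card_addSubgroup φ.ker,
      Nat.card_congr (QuotientAddGroup.quotientKerEquivOfSurjective φ hφ).toEquiv]
  have : Fintype φ.ker := Fintype.ofFinite _
  have hle : s ≤ m * Nat.card φ.ker := by
    have := Nat.mul_le_mul_right (Nat.card φ.ker) hm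
    rw [← hcard, mul_assoc] at this
    omega
  obtain ⟨e⟩ : Nonempty (Fin s ↪ Fin m × φ.ker) :=
    Function.Embedding.nonempty_of_card_le (by
      rwa [Fintype.card_fin, Fintype.card_prod, Fintype.card_fin, ← Nat.card_eq_fintype_card])
  exact ⟨_, hg.comp_injective e.injective⟩

theorem exists_isTripleSystem {G : Type*} [AddCommGroup G] [Finite G] (ι : G)
    (hι0 : ι ≠ 0) (hι2 : ι + ι = 0) (hι : ∀ x : G, x ≠ 0 → x + x = 0 → x = ι) (s : ℕ)
    (hs : 10 * s + 2 ≤ Nat.card G) :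
    ∃ f : Fin s → Fin 3 → G, IsTripleSystem f := by
  by_cases hc : IsAddCyclic G
  · rcases Nat.eq_zero_or_pos s with rfl | hs0
    · exact ⟨finZeroElim, finZeroElim, finZeroElim, finZeroElim⟩
    have h2 : 2 ∣ Nat.card G := by
      rw [← addOrderOf_eq_prime (p := 2) (by rw [two_nsmul, hι2]) hι0]
      exact addOrderOf_dvd_natCard ι
    obtain ⟨f, hf⟩ := exists_isTripleSystem_zmod (Nat.card G) ((Nat.card G - 4) / 6) (by omega)
    have hle : s ≤ (Nat.card G - 4) / 6 := by omega
    have e := zmodAddCyclicAddEquiv hc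
    exact ⟨_, (hf.map_injective e.toAddMonoidHom e.injective).comp_injective
      (Fin.castLE_injective hle)⟩
  · obtain ⟨k, p, hk, hp, hp2, φ, hφ, hφι⟩ := exists_surjective_of_not_isAddCyclic ι hι0 hι2 hι hc
    have hker : ∀ x, φ x = 0 → x + x = 0 → x = 0 := by
      intro x hx hxx
      by_contra h0
      exact hφι (hι x h0 hxx ▸ hx)
    have hM2 : 2 ∣ 2 ^ k * p := (dvd_pow_self 2 hk.ne').mul_right p
    have hpodd := hp.eq_two_or_odd'.resolve_left hp2
    have hp3 : 3 ≤ p := by have := hp.two_le; omega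
    by_cases hbig : 18 ≤ 2 ^ k * p ∨ 2 ^ k * p = 10
    · obtain ⟨f, hf⟩ := exists_isTripleSystem_zmod (2 ^ k * p) ((2 ^ k * p - 4) / 6) (by omega)
      refine exists_isTripleSystem_of_surjective hf ((AddMonoidHom.fst _ _).comp φ)
        (Prod.fst_surjective.comp hφ) ?_ ?_ (by omega)
      · intro x hx hxx
        by_contra h0
        obtain rfl := hι x h0 hxx
        apply hφι
        refine Prod.ext hx ?_
        have hy : (φ x).2 + (φ x).2 = 0 := by
          rw [← Prod.snd_add, ← map_add, hxx, map_zero, Prod.snd_zero]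
        have : Fact p.Prime := ⟨hp⟩
        have h2 : (2 : ZMod p) ≠ 0 := by
          intro h2
          have h2' : ((2 : ℕ) : ZMod p) = 0 := by exact_mod_cast h2
          have := Nat.le_of_dvd (by norm_num) ((ZMod.natCast_eq_zero_iff 2 p).1 h2')
          omega
        rw [← two_mul] at hy
        exact (mul_eq_zero.1 hy).resolve_left h2
      · rw [Nat.card_zmod]
        omega
    · have hk4 : k < 4 := by
        by_contra! hk4
        have := Nat.mul_le_mul (Nat.pow_le_pow_right (n := 2) (by norm_num) hk4) hp3
        omega
      have hp9 : p < 9 := by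
        by_contra! hp9
        have := Nat.mul_le_mul (Nat.pow_le_pow_right (n := 2) (by norm_num) hk) hp9
        omega
      obtain ⟨a, ha⟩ := hpodd
      interval_cases k <;> interval_cases p <;> try omega
      · obtain ⟨f, hf⟩ := exists_isTripleSystem_zmod_six
        exact exists_isTripleSystem_of_surjective hf φ hφ hker (by simp) (by omega)
      · obtain ⟨f, hf⟩ := exists_isTripleSystem_zmod_fourteen
        exact exists_isTripleSystem_of_surjective hf φ hφ hker (by simp) (by omega)
      · obtain ⟨f, hf⟩ := exists_isTripleSystem_zmod_twelve
        exact exists_isTripleSystem_of_surjective hf φ hφ hker (by simp) (by omega)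

section Symmetric

variable {G : Type*} [AddCommGroup G]

theorem sum_eq_zero_of_neg_mem {S : Finset G} (hS : ∀ x ∈ S, -x ∈ S) (hS' : ∀ x ∈ S, -x ≠ x) :
    ∑ x ∈ S, x = 0 :=
  Finset.sum_involution (fun x _ => -x) (by simp) (fun x hx _ => hS' x hx) hS (by simp)

theorem exists_symmetric_subset [DecidableEq G] {S : Finset G} (hS : ∀ x ∈ S, -x ∈ S)
    (hS' : ∀ x ∈ S, -x ≠ x) (m : ℕ) (hm : 2 * m ≤ S.card) :
    ∃ B ⊆ S, (∀ x ∈ B, -x ∈ B) ∧ B.card = 2 * m := by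
  induction m with
  | zero => exact ⟨∅, by simp⟩
  | succ m ih =>
    obtain ⟨B, hBS, hB, hcard⟩ := ih (by omega)
    obtain ⟨x, hxS, hxB⟩ := Finset.exists_mem_notMem_of_card_lt_card (s := B) (t := S) (by omega)
    have hxB' : -x ∉ B := fun h => hxB (by simpa using hB _ h)
    refine ⟨insert x (insert (-x) B), ?_, ?_, ?_⟩
    · simp [insert_subset_iff, hxS, hS x hxS, hBS]
    · intro y hy
      simp only [mem_insert] at hy ⊢
      rcases hy with rfl | rfl | hy
      · simp
      · simp
      · exact Or.inr (Or.inr (hB y hy))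
    · rw [card_insert_of_notMem (by simp [hxB, (hS' x hxS).symm]), card_insert_of_notMem hxB',
        hcard]
      ring

theorem exists_disjoint_symmetric_subsets [DecidableEq G] {J : Type*} [DecidableEq J]
    (T : Finset J) (m : J → ℕ) {S : Finset G} (hS : ∀ x ∈ S, -x ∈ S) (hS' : ∀ x ∈ S, -x ≠ x)
    (hm : ∑ i ∈ T, 2 * m i ≤ S.card) :
    ∃ B : J → Finset G, (∀ i ∈ T, ∀ j ∈ T, i ≠ j → Disjoint (B i) (B j)) ∧
      ∀ i ∈ T, B i ⊆ S ∧ (∀ x ∈ B i, -x ∈ B i) ∧ (B i).card = 2 * m i := by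
  induction T using Finset.induction_on generalizing S with
  | empty => exact ⟨fun _ => ∅, by simp⟩
  | insert a T ha ih =>
    rw [sum_insert ha] at hm
    obtain ⟨C, hCS, hC, hCcard⟩ := exists_symmetric_subset hS hS' (m a) (by omega)
    obtain ⟨B, hB, hB'⟩ := ih (S := S \ C)
      (fun x hx => by
        rw [mem_sdiff] at hx ⊢
        exact ⟨hS x hx.1, fun h => hx.2 (by simpa using hC _ h)⟩)
      (fun x hx => hS' x (mem_sdiff.1 hx).1)
      (by rw [card_sdiff_of_subset hCS]; omega)
    have hne : ∀ i ∈ T, i ≠ a := fun i hi h => ha (h ▸ hi)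
    have hdis : ∀ i ∈ T, Disjoint C (B i) := fun i hi =>
      disjoint_of_subset_right (hB' i hi).1 disjoint_sdiff
    refine ⟨Function.update B a C, ?_, ?_⟩
    · intro i hi' j hj' hij
      rcases mem_insert.1 hi' with rfl | hi <;> rcases mem_insert.1 hj' with rfl | hj
      · exact absurd rfl hij
      · rw [Function.update_self, Function.update_of_ne (hne j hj)]
        exact hdis j hj
      · rw [Function.update_self, Function.update_of_ne (hne i hi)]
        exact (hdis i hi).symm
      · rw [Function.update_of_ne (hne i hi), Function.update_of_ne (hne j hj)]
        exact hB i hi j hj hij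
    · intro i hi
      rcases mem_insert.1 hi with rfl | hi
      · rw [Function.update_self]
        exact ⟨hCS, hC, hCcard⟩
      · rw [Function.update_of_ne (hne i hi)]
        exact ⟨(hB' i hi).1.trans sdiff_subset, (hB' i hi).2⟩

end Symmetric

theorem IsTripleSystem.exists_cores {G : Type*} [AddCommGroup G] [DecidableEq G] {s : ℕ}
    {f : Fin s → Fin 3 → G} (hf : IsTripleSystem f) {J : Type*} (O : Finset J)
    (hO : O.card = 2 * s) :
    ∃ C : J → Finset G, (∀ i ∈ O, ∀ j ∈ O, i ≠ j → Disjoint (C i) (C j)) ∧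
      (∀ i ∈ O, (C i).card = 3 ∧ ∑ x ∈ C i, x = 0) ∧
      (∀ i ∈ O, ∀ x ∈ C i, -x ≠ x ∧ ∃ j ∈ O, -x ∈ C j) := by
  classical
  let g : Fin s × Bool → Fin 3 → G := fun u j => cond u.2 (f u.1 j) (-f u.1 j)
  have hg : ∀ u j u' j', g u j = g u' j' → u = u' ∧ j = j' := by
    rintro ⟨i, b⟩ j ⟨i', b'⟩ j' h
    cases b <;> cases b' <;> simp only [g, cond_true, cond_false] at h
    · obtain ⟨rfl, rfl⟩ := hf.2.1 _ _ _ _ (neg_injective h)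
      simp
    · exact absurd h.symm (hf.2.2 _ _ _ _)
    · exact absurd h (hf.2.2 _ _ _ _)
    · obtain ⟨rfl, rfl⟩ := hf.2.1 _ _ _ _ h
      simp
  have hneg : ∀ u j, -g u j = g (u.1, !u.2) j := by
    rintro ⟨i, b⟩ j
    cases b <;> simp [g]
  have hsum : ∀ u, ∑ j, g u j = 0 := by
    rintro ⟨i, b⟩
    have h := hf.1 i
    cases b
    · simp only [g, cond_false, sum_neg_distrib, Fin.sum_univ_three, h, neg_zero]
    · simp only [g, cond_true, Fin.sum_univ_three, h]
  have E : O ≃ Fin s × Bool := Fintype.equivOfCardEq (by simp [hO, mul_comm])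
  have hginj : ∀ u, Function.Injective (g u) := fun u j j' h => (hg _ _ _ _ h).2
  let C : J → Finset G := fun i => if h : i ∈ O then univ.image (g (E ⟨i, h⟩)) else ∅
  have hC : ∀ i (h : i ∈ O), C i = univ.image (g (E ⟨i, h⟩)) := fun i h => dif_pos h
  refine ⟨C, ?_, ?_, ?_⟩
  · intro i hi j hj hij
    rw [hC i hi, hC j hj, Finset.disjoint_left]
    intro x hx hx'
    obtain ⟨a, -, rfl⟩ := mem_image.1 hx
    obtain ⟨b, -, h⟩ := mem_image.1 hx'
    have := E.injective (hg _ _ _ _ h).1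
    exact hij (congrArg Subtype.val this).symm
  · intro i hi
    rw [hC i hi, card_image_of_injective _ (hginj _), sum_image (hginj _).injOn, hsum]
    simp
  · intro i hi x hx
    rw [hC i hi] at hx
    obtain ⟨a, -, rfl⟩ := mem_image.1 hx
    rw [hneg]
    refine ⟨fun h => ?_, ?_⟩
    · have := congrArg Prod.snd (hg _ _ _ _ h).1
      simp at this
    · obtain ⟨j, hj⟩ := E.surjective ((E ⟨i, hi⟩).1, !(E ⟨i, hi⟩).2)
      refine ⟨j, j.2, ?_⟩
      rw [hC j j.2, hj]
      exact mem_image_of_mem _ (mem_univ _)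

/-- Main zero-sum partition theorem: if `Γ` is a finite abelian group of order `n` with
exactly one involution `ι` and `r₁ + … + r_t = n - 2` with each `rᵢ ≥ 4`, then
`Γ \ {0, ι}` contains pairwise disjoint zero-sum subsets of sizes `r₁, …, r_t`. -/
theorem stmt_12 {Γ : Type*} [AddCommGroup Γ] [Fintype Γ] [DecidableEq Γ]
    (ι : Γ) (hι : {i : Γ | i ≠ 0 ∧ i + i = 0} = {ι})
    (t : ℕ) (r : Fin t → ℕ) (hr : ∀ i, 4 ≤ r i)
    (hsum : ∑ i, r i = Fintype.card Γ - 2) :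
    ∃ A : Fin t → Finset Γ,
      (∀ i j, i ≠ j → Disjoint (A i) (A j)) ∧
      (∀ i, (A i).card = r i ∧ (∑ x ∈ A i, x = 0) ∧ A i ⊆ univ \ {0, ι}) := by
  obtain ⟨hι0, hι2⟩ : ι ≠ 0 ∧ ι + ι = 0 := by
    have : ι ∈ {i : Γ | i ≠ 0 ∧ i + i = 0} := by rw [hι]; rfl
    exact this
  have hinv : ∀ x : Γ, x ≠ 0 → x + x = 0 → x = ι := fun x h0 h2 => by
    have : x ∈ {i : Γ | i ≠ 0 ∧ i + i = 0} := ⟨h0, h2⟩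
    rwa [hι] at this
  have hfix : ∀ x : Γ, x ∈ univ \ {0, ι} ↔ -x ≠ x := by
    intro x
    simp only [mem_sdiff, mem_univ, true_and, mem_insert, mem_singleton, not_or, Ne,
      neg_eq_iff_add_eq_zero]
    refine ⟨fun h h2 => h.2 (hinv x h.1 h2), fun h => ⟨?_, ?_⟩⟩
    · rintro rfl
      exact h (add_zero 0)
    · rintro rfl
      exact h hι2
  have hcard2 : 2 ∣ Fintype.card Γ := by
    rw [← addOrderOf_eq_prime (p := 2) (by rw [two_nsmul, hι2]) hι0]
    exact addOrderOf_dvd_card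
  have hcardV : (univ \ {0, ι} : Finset Γ).card = Fintype.card Γ - 2 := by
    rw [card_sdiff_of_subset (subset_univ _), card_univ, card_pair hι0.symm]
  let O : Finset (Fin t) := {i | Odd (r i)}
  have hmemO : ∀ i, i ∈ O ↔ Odd (r i) := fun i => by simp [O]
  obtain ⟨s, hs⟩ : ∃ s, O.card = 2 * s := by
    have : Even (∑ i, r i) := by rw [hsum, Nat.even_iff]; omega
    exact (((even_sum_iff_even_card_odd r).1 this).two_dvd)
  have hcardpos := Fintype.card_pos_iff.2 ⟨(0 : Γ)⟩
  have hs10 : 10 * s + 2 ≤ Nat.card Γ := by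
    have h1 : O.card * 5 ≤ ∑ i ∈ O, r i := by
      rw [← smul_eq_mul]
      refine card_nsmul_le_sum _ _ _ fun i hi => ?_
      have := hr i
      obtain ⟨a, ha⟩ := (hmemO i).1 hi
      omega
    have h2 : ∑ i ∈ O, r i ≤ ∑ i, r i := sum_le_sum_of_subset (subset_univ _)
    rw [Nat.card_eq_fintype_card]
    omega
  obtain ⟨f, hf⟩ := exists_isTripleSystem ι hι0 hι2 hinv s hs10
  obtain ⟨C, hCdis, hCsum, hCneg⟩ := hf.exists_cores O hs
  let D : Fin t → Finset Γ := fun i => if i ∈ O then C i else ∅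
  have hDO : ∀ i ∈ O, D i = C i := fun i hi => if_pos hi
  have hDO' : ∀ i, i ∉ O → D i = ∅ := fun i hi => if_neg hi
  have hDdis : ∀ i j, i ≠ j → Disjoint (D i) (D j) := by
    intro i j hij
    by_cases hi : i ∈ O
    · by_cases hj : j ∈ O
      · rw [hDO i hi, hDO j hj]
        exact hCdis i hi j hj hij
      · simp [hDO' j hj]
    · simp [hDO' i hi]
  have hDsum : ∀ i, ∑ x ∈ D i, x = 0 := by
    intro i
    by_cases hi : i ∈ O
    · rw [hDO i hi, (hCsum i hi).2]
    · simp [hDO' i hi]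
  have hDcard : ∀ i, ∃ m, r i = (D i).card + 2 * m := by
    intro i
    by_cases hi : i ∈ O
    · rw [hDO i hi, (hCsum i hi).1]
      obtain ⟨a, ha⟩ := (hmemO i).1 hi
      have := hr i
      exact ⟨a - 1, by omega⟩
    · rw [hDO' i hi, card_empty]
      rw [hmemO, Nat.not_odd_iff_even] at hi
      obtain ⟨a, ha⟩ := hi.two_dvd
      exact ⟨a, by omega⟩
  have hDneg : ∀ i, ∀ x ∈ D i, -x ≠ x ∧ ∃ j, -x ∈ D j := by
    intro i x hx
    by_cases hi : i ∈ O
    · rw [hDO i hi] at hx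
      obtain ⟨h, j, hj, h'⟩ := hCneg i hi x hx
      exact ⟨h, j, by rwa [hDO j hj]⟩
    · simp [hDO' i hi] at hx
  choose m hm using hDcard
  let U : Finset Γ := univ.biUnion D
  have hU : U ⊆ univ \ {0, ι} := by
    intro x hx
    obtain ⟨i, -, hi⟩ := mem_biUnion.1 hx
    exact (hfix x).2 (hDneg i x hi).1
  have hUcard : U.card = ∑ i, (D i).card := card_biUnion fun i _ j _ hij => hDdis i j hij
  obtain ⟨B, hBdis, hB⟩ := exists_disjoint_symmetric_subsets univ m (S := (univ \ {0, ι}) \ U)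
    (by
      intro x hx
      rw [mem_sdiff, hfix] at hx ⊢
      refine ⟨fun h => hx.1 (neg_injective h), fun h => hx.2 ?_⟩
      obtain ⟨i, -, hi⟩ := mem_biUnion.1 h
      obtain ⟨-, j, hj⟩ := hDneg i _ hi
      rw [neg_neg] at hj
      exact mem_biUnion.2 ⟨j, mem_univ _, hj⟩)
    (fun x hx => (hfix x).1 (mem_sdiff.1 hx).1)
    (by
      rw [card_sdiff_of_subset hU, hcardV, hUcard, ← hsum, sum_congr rfl fun i _ => hm i,
        sum_add_distrib, Nat.add_sub_cancel_left])
  have hDU : ∀ i, D i ⊆ U := fun i => subset_biUnion_of_mem D (mem_univ i)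
  have hDB : ∀ i j, Disjoint (D i) (B j) := fun i j =>
    disjoint_of_subset_left (hDU i)
      (disjoint_of_subset_right (hB j (mem_univ j)).1 disjoint_sdiff)
  refine ⟨fun i => D i ∪ B i, ?_, fun i => ⟨?_, ?_, ?_⟩⟩
  · intro i j hij
    rw [disjoint_union_left, disjoint_union_right, disjoint_union_right]
    exact ⟨⟨hDdis i j hij, hDB i j⟩, (hDB j i).symm, hBdis i (mem_univ i) j (mem_univ j) hij⟩
  · rw [card_union_of_disjoint (hDB i i), (hB i (mem_univ i)).2.2, hm i]
  · rw [sum_union (hDB i i), hDsum, zero_add]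
    exact sum_eq_zero_of_neg_mem (hB i (mem_univ i)).2.1 fun x hx =>
      (hfix x).1 (mem_sdiff.1 ((hB i (mem_univ i)).1 hx)).1
  · exact union_subset ((hDU i).trans hU) ((hB i (mem_univ i)).1.trans sdiff_subset)
end

section
/- Any directed graph G of order n in which every weakly connected component has order at least 4 has a Γ-irregular labeling for every finite abelian group Γ such that |Γ| ≥ n + 6. -/
open Finset

/-- Weak reachability in a digraph: the reflexive-transitive closure of the
symmetrized adjacency relation. The weakly connected component of `x` is
`{y | WReach Adj x y}`. -/
def WReach {V : Type*} (Adj : V → V → Prop) : V → V → Prop :=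
  Relation.ReflTransGen (fun a b => Adj a b ∨ Adj b a)

/-- The induced vertex map `φ_ψ` of an arc labeling `ψ`:
`φ_ψ(x) = Σ_{y ∈ N⁺(x)} ψ(x,y) − Σ_{y ∈ N⁻(x)} ψ(y,x)`. -/
def vertexSum {V Γ : Type*} [Fintype V] [AddCommGroup Γ]
    (Adj : V → V → Prop) [DecidableRel Adj] (ψ : V → V → Γ) (x : V) : Γ :=
  (∑ y ∈ univ.filter (fun y => Adj x y), ψ x y)
    - (∑ y ∈ univ.filter (fun y => Adj y x), ψ y x)

/-- `G` is realizable in `Γ`: there is a `Γ`-irregular arc labeling, i.e. one whose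
induced vertex map is injective. -/
def Realizable {V : Type*} [Fintype V] (Adj : V → V → Prop) [DecidableRel Adj]
    (Γ : Type*) [AddCommGroup Γ] : Prop :=
  ∃ ψ : V → V → Γ, Function.Injective (vertexSum Adj ψ)

/-- Every family of fewer than `|K|` elements of a finite abelian group `K` is the sum of two
injective families. -/
theorem exists_injOn_sub_injOn {ι K : Type*} [DecidableEq ι] [AddCommGroup K] [Fintype K]
    (d : ι → K) (s : Finset ι) (hs : #s < Fintype.card K) :
    ∃ σ : ι → K, Set.InjOn σ s ∧ Set.InjOn (fun i => d i - σ i) s := by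
  classical
  induction s using Finset.induction_on with
  | empty => exact ⟨fun _ => 0, by simp, by simp⟩
  | insert a s ha ih =>
    rw [card_insert_of_notMem ha] at hs
    obtain ⟨σ, hσ, hπ⟩ := ih (by omega)
    have hcard : 1 < #(s.image σ)ᶜ := by
      have := card_image_le (s := s) (f := σ)
      rw [card_compl]
      omega
    obtain ⟨x, hx, y, hy, hxy⟩ := one_lt_card.1 hcard
    have hx' : ∀ t ∈ s, σ t ≠ x := by simpa using hx
    have hy' : ∀ t ∈ s, σ t ≠ y := by simpa using hy
    obtain ⟨κ, hκ⟩ : ∃ κ, κ = x + y - d a := ⟨_, rfl⟩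
    let Φ : Set ι →o Set ι :=
      ⟨fun T => {t | t ∈ s ∧ (d t - σ t + κ = y ∨ ∃ t' ∈ T, t' ∈ s ∧ d t - σ t + κ = σ t')}, by
        rintro T T' h t ⟨ht, h1 | ⟨t', h2, h3⟩⟩
        · exact ⟨ht, Or.inl h1⟩
        · exact ⟨ht, Or.inr ⟨t', h h2, h3⟩⟩⟩
    obtain ⟨S, hS⟩ : ∃ S : Set ι, ∀ t, t ∈ S ↔ t ∈ s ∧
        (d t - σ t + κ = y ∨ ∃ t' ∈ S, t' ∈ s ∧ d t - σ t + κ = σ t') :=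
      ⟨Φ.lfp, fun t => (Set.ext_iff.1 Φ.map_lfp t).symm⟩
    have hda : d a - x = y - κ := by rw [hκ]; abel
    refine ⟨fun t => if t = a then x else if t ∈ S then d t - σ t + κ else σ t, ?_, ?_⟩
    · have key : ∀ t ∈ s, ∀ t' ∈ s, t ∈ S → t' ∉ S → d t - σ t + κ ≠ σ t' := by
        intro t ht t' ht' h1 h2 h3
        obtain ⟨-, h4 | ⟨u, hu, hus, h4⟩⟩ := (hS t).1 h1
        · exact hy' t' ht' (h3.symm.trans h4)
        · exact h2 (hσ hus ht' (h4.symm.trans h3) ▸ hu)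
      have keyx : ∀ t ∈ s, t ∈ S → d t - σ t + κ ≠ x := by
        intro t ht h1 h3
        obtain ⟨-, h4 | ⟨u, hu, hus, h4⟩⟩ := (hS t).1 h1
        · exact hxy (h3.symm.trans h4)
        · exact hx' u hus (h4.symm.trans h3)
      intro t ht t' ht' h
      have inj : ∀ t ∈ s, ∀ t' ∈ s, d t - σ t + κ = d t' - σ t' + κ → t = t' :=
        fun t ht t' ht' h => hπ ht ht' (add_right_cancel h)
      simp only [coe_insert, Set.mem_insert_iff, mem_coe] at ht ht'
      simp only at h
      split_ifs at h <;> grind [Set.InjOn]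
    · have key : ∀ t ∈ s, ∀ t' ∈ s, t ∈ S → t' ∉ S → d t - (d t - σ t + κ) ≠ d t' - σ t' := by
        intro t ht t' ht' h1 h2 h3
        refine h2 ((hS t').2 ⟨ht', Or.inr ⟨t, h1, ht, ?_⟩⟩)
        rw [← h3]; abel
      have keyx : ∀ t ∈ s, t ∈ S → d t - (d t - σ t + κ) ≠ d a - x := by
        intro t ht h1 h3
        rw [hda] at h3
        apply hy' t ht
        have : σ t = d t - (d t - σ t + κ) + κ := by abel
        rw [this, h3]; abel
      have keyy : ∀ t ∈ s, t ∉ S → d t - σ t ≠ d a - x := by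
        intro t ht h1 h3
        refine h1 ((hS t).2 ⟨ht, Or.inl ?_⟩)
        rw [h3, hda]; abel
      have inj : ∀ t ∈ s, ∀ t' ∈ s,
          d t - (d t - σ t + κ) = d t' - (d t' - σ t' + κ) → t = t' := by
        intro t ht t' ht' h
        refine hσ ht ht' ?_
        have e : ∀ t, d t - (d t - σ t + κ) = σ t - κ := fun t => by abel
        rw [e, e] at h
        exact sub_left_injective h
      have inj' : ∀ t ∈ s, ∀ t' ∈ s, d t - σ t = d t' - σ t' → t = t' :=
        fun t ht t' ht' h => hπ ht ht' h
      intro t ht t' ht' h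
      simp only [coe_insert, Set.mem_insert_iff, mem_coe] at ht ht'
      simp only at h
      split_ifs at h <;> grind

theorem exists_disjoint_subsets {ι α : Type*} [Fintype ι] [DecidableEq α] (S : Finset α)
    (a : ι → ℕ) (h : ∑ i, a i ≤ #S) :
    ∃ A : ι → Finset α, (∀ i, A i ⊆ S) ∧ (∀ i, #(A i) = a i) ∧
      ∀ i j, i ≠ j → Disjoint (A i) (A j) := by
  classical
  obtain ⟨e⟩ : Nonempty ((Σ i, Fin (a i)) ↪ S) :=
    Function.Embedding.nonempty_of_card_le (by simpa using h)
  refine ⟨fun i => univ.image fun j : Fin (a i) => (e ⟨i, j⟩ : α), ?_, ?_, ?_⟩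
  · intro i x hx
    obtain ⟨j, -, rfl⟩ := mem_image.1 hx
    exact (e ⟨i, j⟩).2
  · intro i
    rw [card_image_of_injective, card_univ, Fintype.card_fin]
    intro j j' hj
    simpa using e.injective (Subtype.ext hj)
  · intro i j hij
    rw [disjoint_left]
    intro x hx hx'
    obtain ⟨u, -, rfl⟩ := mem_image.1 hx
    obtain ⟨v, -, hv⟩ := mem_image.1 hx'
    exact hij (congrArg Sigma.fst (e.injective (Subtype.ext hv))).symm

theorem exists_sum_eq_between {ι : Type*} [Fintype ι] (lo hi : ι → ℕ) (P : ℕ)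
    (h : ∀ i, lo i ≤ hi i) (h₁ : ∑ i, lo i ≤ P) (h₂ : P ≤ ∑ i, hi i) :
    ∃ p : ι → ℕ, (∀ i, lo i ≤ p i ∧ p i ≤ hi i) ∧ ∑ i, p i = P := by
  classical
  induction P, h₁ using Nat.le_induction with
  | base => exact ⟨lo, fun i => ⟨le_rfl, h i⟩, rfl⟩
  | succ P _ ih =>
    obtain ⟨p, hp, hP⟩ := ih (by omega)
    obtain ⟨i, -, hi'⟩ : ∃ i ∈ univ, p i < hi i := exists_lt_of_sum_lt (by omega)
    refine ⟨Function.update p i (p i + 1), fun j => ?_, ?_⟩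
    · obtain rfl | hj := eq_or_ne j i
      · have := hp j
        simp only [Function.update_self]
        omega
      · simpa [hj] using hp j
    · have := add_sum_erase univ p (mem_univ i)
      rw [sum_update_of_mem (mem_univ i), sdiff_singleton_eq_erase]
      omega

theorem card_fiber_eq_card_ker {Γ Q : Type*} [AddCommGroup Γ] [Fintype Γ] [AddCommGroup Q]
    [DecidableEq Q] (f : Γ →+ Q) (hf : Function.Surjective f) (q : Q) :
    #{x | f x = q} = Nat.card f.ker := by
  classical
  rw [AddMonoidHom.card_fiber_eq_of_mem_range f (hf q) (hf 0), ← Fintype.card_subtype,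
    ← Nat.card_eq_fintype_card]
  rfl

/-- Lifting prescribed numbers of elements of the fibres of `f : Γ →+ Q` to disjoint zero-sum
sets in `Γ`; the fibres over `b` and `c` absorb the corrections in the kernel. -/
theorem exists_disjoint_sum_eq_zero_of_surjective {ι Γ Q : Type*} [Fintype ι] [AddCommGroup Γ]
    [Fintype Γ] [AddCommGroup Q] [Fintype Q] [DecidableEq Q] (f : Γ →+ Q)
    (hf : Function.Surjective f)
    {b c : Q} (hbc : b ≠ c) {p : ι → ℕ} (hp : ∀ i, 1 ≤ p i) (hP : ∑ i, p i < Nat.card f.ker)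
    {r : Q → ι → ℕ} (hrb : ∀ i, r b i = 0) (hrc : ∀ i, r c i = 0)
    (hr : ∀ q, ∑ i, r q i ≤ Nat.card f.ker)
    (hz : ∀ i, p i • (b + c) + ∑ q, r q i • q = 0) :
    ∃ F : ι → Finset Γ, (∀ i j, i ≠ j → Disjoint (F i) (F j)) ∧
      (∀ i, #(F i) = 2 * p i + ∑ q, r q i) ∧ ∀ i, ∑ x ∈ F i, x = 0 := by
  classical
  have hfib := card_fiber_eq_card_ker f hf
  choose A hAsub hAcard hAdisj using fun q =>
    exists_disjoint_subsets ({x | f x = q} : Finset Γ) (r q) ((hr q).trans (hfib q).ge)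
  have hAf : ∀ q i, ∀ x ∈ A q i, f x = q := fun q i x hx => by simpa using hAsub q i hx
  obtain ⟨β, rfl⟩ := hf b
  obtain ⟨γ, rfl⟩ := hf c
  have he : ∀ i, p i • (β + γ) + ∑ q, ∑ x ∈ A q i, x ∈ f.ker := by
    intro i
    rw [AddMonoidHom.mem_ker, map_add, map_nsmul, map_add, map_sum, ← hz i]
    congr 1
    refine sum_congr rfl fun q _ => ?_
    rw [map_sum, sum_congr rfl (hAf q i), sum_const, hAcard]
  let d : (Σ i, Fin (p i)) → f.ker := fun j => if (j.2 : ℕ) = 0 then -⟨_, he j.1⟩ else 0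
  have hd : ∀ i, ∑ j, (d ⟨i, j⟩ : Γ) = -(p i • (β + γ) + ∑ q, ∑ x ∈ A q i, x) := by
    intro i
    rw [sum_eq_single ⟨0, hp i⟩]
    · simp [d]
    · intro j _ hj
      have : (j : ℕ) ≠ 0 := fun h => hj (Fin.ext h)
      simp [d, this]
    · simp
  obtain ⟨σ, hσ, hπ⟩ := exists_injOn_sub_injOn d univ
    (by simpa [← Nat.card_eq_fintype_card (α := f.ker)] using hP)
  rw [coe_univ, Set.injOn_univ] at hσ hπ
  let u : (Σ i, Fin (p i)) → Γ := fun j => β + σ j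
  let v : (Σ i, Fin (p i)) → Γ := fun j => γ + ((d j - σ j : f.ker) : Γ)
  have hu : Function.Injective u := fun x y h => hσ (Subtype.ext (add_left_cancel h))
  have hv : Function.Injective v := fun x y h => hπ (Subtype.ext (add_left_cancel h))
  have hfu : ∀ j, f (u j) = f β := fun j => by
    have := (σ j).2
    rw [AddMonoidHom.mem_ker] at this
    simp [u, this]
  have hfv : ∀ j, f (v j) = f γ := fun j => by
    have := (d j - σ j).2
    rw [AddMonoidHom.mem_ker] at this
    simp only [v, map_add, this, add_zero]
  let B : Q → ι → Finset Γ := fun q i =>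
    if q = f β then univ.image fun j => u ⟨i, j⟩
    else if q = f γ then univ.image fun j => v ⟨i, j⟩ else A q i
  have hBf : ∀ q i, ∀ x ∈ B q i, f x = q := by
    intro q i x hx
    simp only [B] at hx
    split_ifs at hx with h1 h2
    · obtain ⟨j, -, rfl⟩ := mem_image.1 hx
      rw [hfu, h1]
    · obtain ⟨j, -, rfl⟩ := mem_image.1 hx
      rw [hfv, h2]
    · exact hAf q i x hx
  have huinj : ∀ i, Function.Injective fun j => u ⟨i, j⟩ := fun i j j' h => by simpa using hu h
  have hvinj : ∀ i, Function.Injective fun j => v ⟨i, j⟩ := fun i j j' h => by simpa using hv h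
  have hBdisj : ∀ q i j, i ≠ j → Disjoint (B q i) (B q j) := by
    intro q i j hij
    simp only [B]
    split_ifs
    · simp only [disjoint_left, mem_image, mem_univ, true_and]
      rintro _ ⟨x, rfl⟩ ⟨y, h⟩
      exact hij (congrArg Sigma.fst (hu h)).symm
    · simp only [disjoint_left, mem_image, mem_univ, true_and]
      rintro _ ⟨x, rfl⟩ ⟨y, h⟩
      exact hij (congrArg Sigma.fst (hv h)).symm
    · exact hAdisj q i j hij
  have hA0 : ∀ i, A (f β) i = ∅ ∧ A (f γ) i = ∅ := fun i =>
    ⟨card_eq_zero.1 ((hAcard _ i).trans (hrb i)), card_eq_zero.1 ((hAcard _ i).trans (hrc i))⟩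
  have hBcard : ∀ i q, #(B q i) =
      (if q = f β then p i else 0) + (if q = f γ then p i else 0) + r q i := by
    intro i q
    simp only [B]
    obtain rfl | h1 := eq_or_ne q (f β)
    · simp [hbc, hrb, card_image_of_injective _ (huinj i)]
    · obtain rfl | h2 := eq_or_ne q (f γ)
      · simp [h1, hrc, card_image_of_injective _ (hvinj i)]
      · simp [h1, h2, hAcard]
  have hBsum : ∀ i q, ∑ x ∈ B q i, x = (if q = f β then ∑ j, u ⟨i, j⟩ else 0) +
      (if q = f γ then ∑ j, v ⟨i, j⟩ else 0) + ∑ x ∈ A q i, x := by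
    intro i q
    simp only [B]
    obtain rfl | h1 := eq_or_ne q (f β)
    · simp [hbc, hA0, sum_image (huinj i).injOn]
    · obtain rfl | h2 := eq_or_ne q (f γ)
      · simp [h1, hA0, sum_image (hvinj i).injOn]
      · simp [h1, h2]
  have hpair : ∀ i, Set.PairwiseDisjoint ((univ : Finset Q) : Set Q) fun q => B q i := by
    intro i q _ q' _ h
    exact disjoint_left.2 fun x hx hx' => h ((hBf q i x hx).symm.trans (hBf q' i x hx'))
  refine ⟨fun i => univ.biUnion fun q => B q i, ?_, ?_, ?_⟩
  · intro i j hij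
    simp only [disjoint_biUnion_left, disjoint_biUnion_right]
    intro q' _ q _
    obtain rfl | h := eq_or_ne q q'
    · exact hBdisj q i j hij
    · exact disjoint_left.2 fun x hx hx' => h ((hBf _ i x hx).symm.trans (hBf _ j x hx'))
  · intro i
    rw [card_biUnion fun q _ q' _ h => hpair i (mem_univ q) (mem_univ q') h,
      sum_congr rfl fun q _ => hBcard i q]
    simp only [sum_add_distrib, sum_ite_eq', mem_univ, if_true]
    omega
  · intro i
    rw [sum_biUnion (hpair i), sum_congr rfl fun q _ => hBsum i q]
    simp only [sum_add_distrib, sum_ite_eq', mem_univ, if_true]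
    have : ∑ j, v ⟨i, j⟩ =
        p i • γ + (-(p i • (β + γ) + ∑ q, ∑ x ∈ A q i, x) - ∑ j, (σ ⟨i, j⟩ : Γ)) := by
      rw [← hd, ← sum_sub_distrib]
      simp [v, sum_add_distrib]
    rw [this]
    simp only [u, sum_add_distrib, sum_const, card_univ, Fintype.card_fin, nsmul_add]
    abel

theorem card_mul_four_le_sum {ι : Type*} [Fintype ι] {n : ι → ℕ} (hn : ∀ i, 4 ≤ n i) :
    Fintype.card ι * 4 ≤ ∑ i, n i := by
  simpa using card_nsmul_le_sum univ n 4 fun i _ => hn i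

theorem card_ker_mul_card {Γ Q : Type*} [AddCommGroup Γ] [Fintype Γ] [AddCommGroup Q]
    [Fintype Q] (f : Γ →+ Q) (hf : Function.Surjective f) :
    Nat.card f.ker * Fintype.card Q = Fintype.card Γ := by
  rw [← Nat.card_eq_fintype_card, ← Nat.card_eq_fintype_card, ← f.ker.card_mul_index,
    AddSubgroup.index_ker, AddMonoidHom.range_eq_top.2 hf, AddSubgroup.card_top]

theorem exists_disjoint_sum_eq_zero_of_zmod_three {ι Γ : Type*} [Fintype ι] [AddCommGroup Γ]
    [Fintype Γ] (f : Γ →+ ZMod 3) (hf : Function.Surjective f) {n : ι → ℕ}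
    (hn : ∀ i, 4 ≤ n i) (hΓ : ∑ i, n i + 6 ≤ Fintype.card Γ) :
    ∃ F : ι → Finset Γ, (∀ i j, i ≠ j → Disjoint (F i) (F j)) ∧
      (∀ i, #(F i) = n i) ∧ ∀ i, ∑ x ∈ F i, x = 0 := by
  have hk := card_mul_four_le_sum hn
  have hm := card_ker_mul_card f hf
  rw [ZMod.card] at hm
  have h1 : ∑ _i : ι, 1 = Fintype.card ι := by simp
  have hhalf : ∑ i, n i ≤ 2 * ∑ i, n i / 2 + ∑ _i : ι, 1 := by
    rw [mul_sum, ← sum_add_distrib]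
    exact sum_le_sum fun i _ => by omega
  obtain ⟨p, hp, hP⟩ := exists_sum_eq_between (fun _ => 1) (fun i => n i / 2)
    (min (Nat.card f.ker - 1) (∑ i, n i / 2)) (fun i => by have := hn i; omega) (by omega)
    (min_le_right _ _)
  have hr : ∑ i, n i = 2 * ∑ i, p i + ∑ i, (n i - 2 * p i) := by
    rw [mul_sum, ← sum_add_distrib]
    exact sum_congr rfl fun i _ => by have := hp i; omega
  obtain ⟨F, hF, hcard, hsum⟩ := exists_disjoint_sum_eq_zero_of_surjective f hf
    (b := 1) (c := 2) (by decide) (fun i => (hp i).1) (by omega)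
    (r := fun q i => if q = 0 then n i - 2 * p i else 0) (fun i => if_neg (by decide))
    (fun i => if_neg (by decide))
    (fun q => by
      split_ifs
      · omega
      · simp)
    (fun i => by
      have : (1 + 2 : ZMod 3) = 0 := by decide
      simp [this])
  refine ⟨F, hF, fun i => ?_, hsum⟩
  have := hp i
  rw [hcard, sum_ite_eq' univ, if_pos (mem_univ _)]
  omega

theorem exists_disjoint_sum_eq_zero_of_zmod_four {ι Γ : Type*} [Fintype ι] [AddCommGroup Γ]
    [Fintype Γ] (f : Γ →+ ZMod 4) (hf : Function.Surjective f) {n : ι → ℕ}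
    (hn : ∀ i, 4 ≤ n i) (hΓ : ∑ i, n i + 6 ≤ Fintype.card Γ) :
    ∃ F : ι → Finset Γ, (∀ i j, i ≠ j → Disjoint (F i) (F j)) ∧
      (∀ i, #(F i) = n i) ∧ ∀ i, ∑ x ∈ F i, x = 0 := by
  have hk := card_mul_four_le_sum hn
  have hm := card_ker_mul_card f hf
  rw [ZMod.card] at hm
  have h1 : ∑ _i : ι, 1 = Fintype.card ι := by simp
  have hhalf : ∑ i, n i ≤ 2 * ∑ i, n i / 2 + ∑ _i : ι, 1 := by
    rw [mul_sum, ← sum_add_distrib]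
    exact sum_le_sum fun i _ => by omega
  obtain ⟨p, hp, hP⟩ := exists_sum_eq_between (fun _ => 1) (fun i => n i / 2)
    (min (Nat.card f.ker - 1) (∑ i, n i / 2)) (fun i => by have := hn i; omega) (by omega)
    (min_le_right _ _)
  have hsub : ∑ i, n i / 2 = ∑ i, p i + ∑ i, (n i / 2 - p i) := by
    rw [← sum_add_distrib]
    exact sum_congr rfl fun i _ => by have := hp i; omega
  obtain ⟨b, hb, hB⟩ := exists_sum_eq_between (fun _ => 0) (fun i => n i / 2 - p i)
    (min (Nat.card f.ker / 2) (∑ i, (n i / 2 - p i))) (fun i => by omega) (by simp)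
    (min_le_right _ _)
  have hr : ∑ i, n i = 2 * ∑ i, p i + 2 * ∑ i, b i + ∑ i, (n i - 2 * p i - 2 * b i) := by
    rw [mul_sum, mul_sum, ← sum_add_distrib, ← sum_add_distrib]
    exact sum_congr rfl fun i _ => by have := hp i; have := hb i; omega
  obtain ⟨F, hF, hcard, hsum⟩ := exists_disjoint_sum_eq_zero_of_surjective f hf
    (b := 1) (c := 3) (by decide) (fun i => (hp i).1) (by omega)
    (r := fun q i => (if q = 0 then n i - 2 * p i - 2 * b i else 0) +
      if q = 2 then 2 * b i else 0) (fun i => by rw [if_neg (by decide), if_neg (by decide)])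
    (fun i => by rw [if_neg (by decide), if_neg (by decide)])
    (fun q => by
      have : (0 : ZMod 4) ≠ 2 := by decide
      obtain rfl | h0 := eq_or_ne q 0
      · simp only [if_true, this, if_false, add_zero]
        omega
      · obtain rfl | h2 := eq_or_ne q 2
        · simp only [if_true, this.symm, if_false, zero_add, ← mul_sum]
          omega
        · simp [h0, h2])
    (fun i => by
      have h4 : (1 + 3 : ZMod 4) = 0 := by decide
      have h2 : 2 • (2 : ZMod 4) = 0 := by decide
      simp only [h4, smul_zero, zero_add, add_smul, sum_add_distrib, ite_smul, zero_smul,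
        sum_ite_eq', mem_univ, if_true, mul_comm 2, mul_smul, h2])
  refine ⟨F, hF, fun i => ?_, hsum⟩
  have := hp i
  have := hb i
  rw [hcard]
  simp only [sum_add_distrib, sum_ite_eq', mem_univ, if_true]
  omega

theorem exists_disjoint_sum_eq_zero_of_zmod_two_prod {ι Γ : Type*} [Fintype ι] [AddCommGroup Γ]
    [Fintype Γ] (f : Γ →+ ZMod 2 × ZMod 2) (hf : Function.Surjective f) {n : ι → ℕ}
    (hn : ∀ i, 4 ≤ n i) (hΓ : ∑ i, n i + 6 ≤ Fintype.card Γ) :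
    ∃ F : ι → Finset Γ, (∀ i j, i ≠ j → Disjoint (F i) (F j)) ∧
      (∀ i, #(F i) = n i) ∧ ∀ i, ∑ x ∈ F i, x = 0 := by
  have hk := card_mul_four_le_sum hn
  have hm := card_ker_mul_card f hf
  rw [Fintype.card_prod, ZMod.card] at hm
  have h1 : ∑ _i : ι, 1 = Fintype.card ι := by simp
  have hhalf : ∑ i, n i ≤ 2 * ∑ i, (n i - 1) / 2 + 2 * ∑ _i : ι, 1 := by
    rw [mul_sum, mul_sum, ← sum_add_distrib]
    exact sum_le_sum fun i _ => by omega
  obtain ⟨p, hp, hP⟩ := exists_sum_eq_between (fun _ => 1) (fun i => (n i - 1) / 2)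
    (min (Nat.card f.ker - 1) (∑ i, (n i - 1) / 2)) (fun i => by have := hn i; omega) (by omega)
    (min_le_right _ _)
  have hpar : ∑ i, p i % 2 ≤ ∑ _i : ι, 1 := sum_le_sum fun i _ => by omega
  have hsub : ∑ i, n i ≤ 2 * ∑ i, p i + ∑ i, p i % 2 +
      2 * ∑ i, (n i - 2 * p i - p i % 2) / 2 + ∑ _i : ι, 1 := by
    rw [mul_sum, mul_sum, ← sum_add_distrib, ← sum_add_distrib, ← sum_add_distrib]
    exact sum_le_sum fun i _ => by have := hp i; omega
  obtain ⟨b, hb, hB⟩ := exists_sum_eq_between (fun _ => 0)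
    (fun i => (n i - 2 * p i - p i % 2) / 2)
    (min ((Nat.card f.ker - ∑ i, p i % 2) / 2) (∑ i, (n i - 2 * p i - p i % 2) / 2))
    (fun i => by omega) (by simp) (min_le_right _ _)
  have hr : ∑ i, n i = 2 * ∑ i, p i + (∑ i, p i % 2 + 2 * ∑ i, b i) +
      ∑ i, (n i - 2 * p i - (p i % 2 + 2 * b i)) := by
    rw [mul_sum, mul_sum, ← sum_add_distrib, ← sum_add_distrib, ← sum_add_distrib]
    exact sum_congr rfl fun i _ => by have := hp i; have := hb i; have := hn i; omega
  obtain ⟨F, hF, hcard, hsum⟩ := exists_disjoint_sum_eq_zero_of_surjective f hf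
    (b := (1, 0)) (c := (0, 1)) (by decide) (fun i => (hp i).1) (by omega)
    (r := fun q i => (if q = 0 then n i - 2 * p i - (p i % 2 + 2 * b i) else 0) +
      if q = (1, 1) then p i % 2 + 2 * b i else 0) (by simp) (by simp)
    (fun q => by
      have : (0 : ZMod 2 × ZMod 2) ≠ (1, 1) := by decide
      obtain rfl | h0 := eq_or_ne q 0
      · simp only [if_true, this, if_false, add_zero]
        omega
      · obtain rfl | h2 := eq_or_ne q (1, 1)
        · simp only [if_true, this.symm, if_false, zero_add, sum_add_distrib, ← mul_sum]
          omega
        · simp [h0, h2])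
    (fun i => by
      have h4 : ((1, 0) + (0, 1) : ZMod 2 × ZMod 2) = (1, 1) := by decide
      have h2 : 2 • ((1, 1) : ZMod 2 × ZMod 2) = 0 := by decide
      have he : p i + (p i % 2 + 2 * b i) = (p i / 2 + p i % 2 + b i) * 2 := by omega
      rw [h4]
      simp only [add_smul _ _ (_ : ZMod 2 × ZMod 2), sum_add_distrib, ite_smul, zero_smul,
        sum_ite_eq', mem_univ, if_true, smul_zero, zero_add]
      rw [← add_smul, ← add_smul, he, mul_smul, h2, smul_zero])
  refine ⟨F, hF, fun i => ?_, hsum⟩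
  have := hp i
  have := hb i
  have := hn i
  rw [hcard]
  simp only [sum_add_distrib, sum_ite_eq', mem_univ, if_true]
  omega

/-- If an abelian group has at most two elements with `x = -x` and about half as many zero-sum
triples, disjoint up to sign, as there are odd values of `n`, then it has disjoint zero-sum sets of
the cardinalities `n`, made of triples, negated triples and pairs `{x, -x}`. -/
theorem exists_disjoint_sum_eq_zero_of_card_triples {ι Γ I : Type*} [Fintype ι] [AddCommGroup Γ]
    [Fintype Γ] [DecidableEq Γ] [Fintype I] (h2 : #{x : Γ | x = -x} ≤ 2) {a : I × Fin 3 → Γ}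
    (ha : Function.Injective a) (hneg : ∀ u v, a u ≠ -a v) (hsum : ∀ i, ∑ j, a (i, j) = 0)
    {n : ι → ℕ} (hn : ∀ i, 4 ≤ n i) (hΓ : ∑ i, n i + 6 ≤ Fintype.card Γ)
    (hI : ∑ i, n i % 2 ≤ 2 * Fintype.card I) (hI' : 2 * Fintype.card I ≤ ∑ i, n i % 2 + 1) :
    ∃ F : ι → Finset Γ, (∀ i j, i ≠ j → Disjoint (F i) (F j)) ∧
      (∀ i, #(F i) = n i) ∧ ∀ i, ∑ x ∈ F i, x = 0 := by
  classical
  let s : I × Bool → Fin 3 → Γ := fun k j => if k.2 then -a (k.1, j) else a (k.1, j)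
  have hs : ∀ k j k' j', s k j = s k' j' → k = k' ∧ j = j' := by
    rintro ⟨k, _ | _⟩ j ⟨k', _ | _⟩ j' h <;>
      simp only [s, if_true, Bool.false_eq_true, if_false] at h
    · simpa using ha h
    · exact absurd h (hneg _ _)
    · exact absurd h.symm (hneg _ _)
    · simpa using ha (neg_injective h)
  have hsneg : ∀ k j, ∃ k', s k' j = -s k j := by
    rintro ⟨k, _ | _⟩ j
    · exact ⟨(k, true), by simp [s]⟩
    · exact ⟨(k, false), by simp [s]⟩
  have hssum : ∀ k, ∑ j, s k j = 0 := by
    rintro ⟨k, _ | _⟩ <;> simp [s, hsum]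
  let U : Finset Γ := univ.image fun u : (I × Bool) × Fin 3 => s u.1 u.2
  have hU : #U ≤ 6 * Fintype.card I := by
    refine card_image_le.trans ?_
    rw [card_univ, Fintype.card_prod, Fintype.card_prod, Fintype.card_bool, Fintype.card_fin]
    omega
  have hUneg : ∀ x, -x ∈ U → x ∈ U := by
    intro x hx
    obtain ⟨⟨k, j⟩, -, h⟩ := mem_image.1 hx
    obtain ⟨k', h'⟩ := hsneg k j
    refine mem_image.2 ⟨(k', j), mem_univ _, ?_⟩
    simp only at h
    rw [h', h, neg_neg]
  obtain ⟨e⟩ : Nonempty ({i // n i % 2 = 1} ↪ I × Bool) := by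
    refine Function.Embedding.nonempty_of_card_le ?_
    rw [Fintype.card_prod, Fintype.card_bool, Fintype.card_subtype, card_filter, mul_comm]
    refine le_trans (sum_le_sum fun i _ => ?_) hI
    split_ifs <;> omega
  let T : ι → Finset Γ := fun i =>
    if h : n i % 2 = 1 then univ.image (s (e ⟨i, h⟩)) else ∅
  have hTU : ∀ i, T i ⊆ U := by
    intro i x hx
    simp only [T] at hx
    split_ifs at hx with h
    · obtain ⟨j, -, rfl⟩ := mem_image.1 hx
      exact mem_image.2 ⟨(e ⟨i, h⟩, j), mem_univ _, rfl⟩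
    · simp at hx
  have hsinj : ∀ k, Function.Injective (s k) := fun k j j' h => (hs _ _ _ _ h).2
  have hTcard : ∀ i, #(T i) = 3 * (n i % 2) := by
    intro i
    simp only [T]
    split_ifs with h
    · rw [card_image_of_injective _ (hsinj _), card_univ, Fintype.card_fin, h]
    · rw [card_empty]
      omega
  have hTsum : ∀ i, ∑ x ∈ T i, x = 0 := by
    intro i
    simp only [T]
    split_ifs with h
    · rw [sum_image (hsinj _).injOn, hssum]
    · rfl
  have hTdisj : ∀ i j, i ≠ j → Disjoint (T i) (T j) := by
    intro i j hij
    rw [disjoint_left]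
    intro x hx hx'
    simp only [T] at hx hx'
    split_ifs at hx hx' with h h'
    · obtain ⟨u, -, rfl⟩ := mem_image.1 hx
      obtain ⟨v, -, hv⟩ := mem_image.1 hx'
      exact hij (by simpa using (e.injective (hs _ _ _ _ hv).1).symm)
    all_goals simp at hx hx'
  obtain ⟨o⟩ : Nonempty (Γ ≃ Fin (Fintype.card Γ)) := ⟨Fintype.equivFin Γ⟩
  let H : Finset Γ := {x | x ∉ U ∧ o x < o (-x)}
  have hH : 2 * #H + #U + #{x : Γ | x = -x} ≥ Fintype.card Γ := by
    have : (univ : Finset Γ) ⊆ H ∪ H.image (-·) ∪ U ∪ ({x : Γ | x = -x} : Finset Γ) := by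
      intro x _
      by_cases hx : x ∈ U
      · simp [hx]
      · obtain h | h | h := lt_trichotomy (o x) (o (-x))
        · simp [H, hx, h]
        · simp [← o.injective h]
        · have : -x ∉ U := fun h => hx (hUneg x h)
          have : x ∈ H.image (-·) := mem_image.2 ⟨-x, by simp [H, this, h], neg_neg x⟩
          simp only [mem_union, this, true_or, or_true]
    have h1 := card_le_card this
    have h2 : #(H ∪ H.image (-·) ∪ U ∪ ({x : Γ | x = -x} : Finset Γ)) ≤ _ := card_union_le _ _
    have h3 : #(H ∪ H.image (-·) ∪ U) ≤ _ := card_union_le _ _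
    have h4 : #(H ∪ H.image (-·)) ≤ _ := card_union_le _ _
    have h5 : #(H.image (-·)) ≤ #H := card_image_le
    rw [card_univ] at h1
    omega
  have hcount : ∑ i, n i = 2 * ∑ i, (n i - 3 * (n i % 2)) / 2 + 3 * ∑ i, n i % 2 := by
    rw [mul_sum, mul_sum, ← sum_add_distrib]
    exact sum_congr rfl fun i _ => by have := hn i; omega
  obtain ⟨B, hBH, hBcard, hBdisj⟩ :=
    exists_disjoint_subsets H (fun i => (n i - 3 * (n i % 2)) / 2) (by omega)
  have hBU : ∀ i, ∀ x ∈ B i, x ∉ U ∧ o x < o (-x) := fun i x hx => by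
    simpa [H] using hBH i hx
  have hBB : ∀ i j, Disjoint (B i) ((B j).image (-·)) := by
    intro i j
    rw [disjoint_left]
    intro x hx hx'
    obtain ⟨y, hy, rfl⟩ := mem_image.1 hx'
    have h1 := (hBU i _ hx).2
    rw [neg_neg] at h1
    exact lt_asymm h1 (hBU j _ hy).2
  have hBT : ∀ i j, Disjoint (B i ∪ (B i).image (-·)) (T j) := by
    intro i j
    rw [disjoint_left]
    intro x hx hx'
    obtain hx | hx := mem_union.1 hx
    · exact (hBU i x hx).1 (hTU j hx')
    · obtain ⟨y, hy, rfl⟩ := mem_image.1 hx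
      exact (hBU i y hy).1 (hUneg _ (hTU j hx'))
  refine ⟨fun i => (B i ∪ (B i).image (-·)) ∪ T i, ?_, ?_, ?_⟩
  · intro i j hij
    have h1 : Disjoint ((B i).image (-·)) ((B j).image (-·)) :=
      (disjoint_image neg_injective).2 (hBdisj i j hij)
    have h2 : Disjoint (B i ∪ (B i).image (-·)) (B j ∪ (B j).image (-·)) := by
      rw [disjoint_union_left, disjoint_union_right, disjoint_union_right]
      exact ⟨⟨hBdisj i j hij, hBB i j⟩, (hBB j i).symm, h1⟩
    exact disjoint_union_left.2 ⟨disjoint_union_right.2 ⟨h2, hBT i j⟩,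
      disjoint_union_right.2 ⟨(hBT j i).symm, hTdisj i j hij⟩⟩
  · intro i
    rw [card_union_of_disjoint (hBT i i), card_union_of_disjoint (hBB i i),
      card_image_of_injective _ neg_injective, hBcard, hTcard]
    have := hn i
    omega
  · intro i
    rw [sum_union (hBT i i), sum_union (hBB i i), hTsum, sum_image neg_injective.injOn,
      sum_neg_distrib, add_neg_cancel, add_zero]

theorem exists_disjoint_sum_eq_zero_of_triples {ι Γ I : Type*} [Fintype ι] [AddCommGroup Γ]
    [Fintype Γ] [DecidableEq Γ] [Fintype I] (h2 : #{x : Γ | x = -x} ≤ 2) {a : I × Fin 3 → Γ}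
    (ha : Function.Injective a) (hneg : ∀ u v, a u ≠ -a v) (hsum : ∀ i, ∑ j, a (i, j) = 0)
    {n : ι → ℕ} (hn : ∀ i, 4 ≤ n i) (hΓ : ∑ i, n i + 6 ≤ Fintype.card Γ)
    (hI : ∑ i, n i % 2 ≤ 2 * Fintype.card I) :
    ∃ F : ι → Finset Γ, (∀ i j, i ≠ j → Disjoint (F i) (F j)) ∧
      (∀ i, #(F i) = n i) ∧ ∀ i, ∑ x ∈ F i, x = 0 := by
  obtain ⟨e⟩ : Nonempty (Fin ((∑ i, n i % 2 + 1) / 2) ↪ I) :=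
    Function.Embedding.nonempty_of_card_le (by rw [Fintype.card_fin]; omega)
  refine exists_disjoint_sum_eq_zero_of_card_triples h2
    (a := fun u : Fin ((∑ i, n i % 2 + 1) / 2) × Fin 3 => a (e u.1, u.2)) ?_
    (fun u v => hneg _ _) (fun i => hsum _) hn hΓ ?_ ?_
  · rintro ⟨k, j⟩ ⟨k', j'⟩ h
    simpa using ha h
  all_goals
    rw [Fintype.card_fin]
    omega

theorem eq_of_two_nsmul_eq_of_odd_card {K : Type*} [AddCommGroup K] (hK : Odd (Nat.card K))
    {x y : K} (h : 2 • x = 2 • y) : x = y :=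
  (Nat.Coprime.nsmul_right_bijective (hK.coprime_two_right)).injective h

theorem eq_of_two_nsmul_eq_of_mem {Γ : Type*} [AddCommGroup Γ] {K : AddSubgroup Γ}
    (hK : Odd (Nat.card K)) {x y : Γ} (hx : x ∈ K) (hy : y ∈ K) (h : 2 • x = 2 • y) : x = y :=
  congrArg Subtype.val (eq_of_two_nsmul_eq_of_odd_card hK (x := ⟨x, hx⟩) (y := ⟨y, hy⟩)
    (Subtype.ext h))

theorem card_eq_neg_le_two {Γ : Type*} [AddCommGroup Γ] [Fintype Γ] [DecidableEq Γ] {M : ℕ}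
    [NeZero M] (f : Γ →+ ZMod M) (hodd : Odd (Nat.card f.ker)) :
    #{x : Γ | x = -x} ≤ 2 := by
  refine (card_le_card_of_injOn (t := {0, ((M / 2 : ℕ) : ZMod M)}) f ?_ ?_).trans card_le_two
  · intro x hx
    have hx : x = -x := by simpa using hx
    have h : f x + f x = 0 := by rw [← map_add, eq_neg_iff_add_eq_zero.1 hx, map_zero]
    have hlt := ZMod.val_lt (f x)
    rw [← ZMod.natCast_zmod_val (f x), ← Nat.cast_add, ZMod.natCast_eq_zero_iff] at h
    obtain ⟨c, hc⟩ := h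
    simp only [coe_insert, coe_singleton, Set.mem_insert_iff, Set.mem_singleton_iff]
    have : c < 2 := by
      by_contra! h
      have := Nat.mul_le_mul_left M h
      omega
    interval_cases c
    · left
      exact (ZMod.val_eq_zero _).1 (by omega)
    · right
      rw [← ZMod.natCast_zmod_val (f x)]
      congr 1
      omega
  · intro x hx y hy hxy
    have hx : x = -x := by simpa using hx
    have hy : y = -y := by simpa using hy
    refine sub_eq_zero.1 (eq_of_two_nsmul_eq_of_mem hodd (x := x - y)
      (f.mem_ker.2 (by rw [map_sub, hxy, sub_self])) f.ker.zero_mem ?_)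
    rw [nsmul_sub, two_nsmul, two_nsmul, eq_neg_iff_add_eq_zero.1 hx,
      eq_neg_iff_add_eq_zero.1 hy, sub_zero, nsmul_zero]

theorem exists_signed_injective_triples {Γ : Type*} [AddCommGroup Γ] {M : ℕ}
    (f : Γ →+ ZMod M) (hf : Function.Surjective f) (hodd : Odd (Nat.card f.ker)) {q : ℕ}
    (hq : 8 * q ≤ M + 1) (X : Set f.ker) (hX : ∀ x ∈ X, ∀ y ∈ X, x ≠ -y)
    (hXM : X.Nonempty → 8 * q + 3 ≤ M) :
    ∃ a : ((Fin q × f.ker) ⊕ X) × Fin 3 → Γ, Function.Injective a ∧ (∀ u v, a u ≠ -a v) ∧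
      ∀ i, ∑ j, a (i, j) = 0 := by
  obtain ⟨g, hg⟩ := hf 1
  let l : (Fin q × f.ker) ⊕ X → Fin 3 → ℤ :=
    Sum.elim (fun k => ![2 * (k.1 : ℤ) + 1, 3 * q - 1 - k.1, -(3 * q + k.1)])
      (fun _ => ![4 * q + 1, -(4 * q + 1), 0])
  let y : (Fin q × f.ker) ⊕ X → f.ker := Sum.elim Prod.snd Subtype.val
  let κ : (Fin q × f.ker) ⊕ X → Fin 3 → f.ker := fun k => ![y k, y k, -(2 • y k)]
  have hl : ∀ k j, 2 * |l k j| < M := by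
    rintro (⟨k, x⟩ | x) j
    · have := k.2
      fin_cases j <;> simp [l] <;> grind
    · have := hXM ⟨x, x.2⟩
      fin_cases j <;> simp [l] <;> grind
  let a : ((Fin q × f.ker) ⊕ X) × Fin 3 → Γ := fun u => l u.1 u.2 • g + κ u.1 u.2
  have hfa : ∀ u, f (a u) = (l u.1 u.2 : ZMod M) := by
    intro u
    have := f.mem_ker.1 (κ u.1 u.2).2
    simp [a, hg, this]
  have hcast : ∀ z : ℤ, |z| < M → (z : ZMod M) = 0 → z = 0 := by
    intro z hz h
    rw [ZMod.intCast_zmod_eq_zero_iff_dvd] at h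
    exact Int.eq_zero_of_abs_lt_dvd h hz
  have hpos : ∀ u v, a u = a v → l u.1 u.2 = l v.1 v.2 ∧ κ u.1 u.2 = κ v.1 v.2 := by
    intro u v h
    have h1 : l u.1 u.2 = l v.1 v.2 := by
      refine sub_eq_zero.1 (hcast _ ?_ (by rw [Int.cast_sub, ← hfa, ← hfa, h, sub_self]))
      have := hl u.1 u.2
      have := hl v.1 v.2
      have := abs_sub (l u.1 u.2) (l v.1 v.2)
      omega
    refine ⟨h1, Subtype.ext ?_⟩
    simp only [a, h1] at h
    exact add_left_cancel h
  have hneg : ∀ u v, a u = -a v → l u.1 u.2 = -l v.1 v.2 ∧ κ u.1 u.2 = -κ v.1 v.2 := by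
    intro u v h
    have h1 : l u.1 u.2 = -l v.1 v.2 := by
      refine eq_neg_of_add_eq_zero_left (hcast _ ?_
        (by rw [Int.cast_add, ← hfa, ← hfa, h, map_neg, neg_add_cancel]))
      have := hl u.1 u.2
      have := hl v.1 v.2
      have := abs_add_le (l u.1 u.2) (l v.1 v.2)
      omega
    refine ⟨h1, Subtype.ext ?_⟩
    simp only [a, h1, neg_add, neg_smul] at h
    exact add_left_cancel h
  have hκ : ∀ k k' j, κ k j = κ k' j → y k = y k' := by
    intro k k' j h
    fin_cases j
    · exact h
    · exact h
    · exact eq_of_two_nsmul_eq_of_odd_card hodd (neg_injective h)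
  refine ⟨a, ?_, ?_, ?_⟩
  · rintro ⟨k, j⟩ ⟨k', j'⟩ h
    obtain ⟨h1, h2⟩ := hpos _ _ h
    have hj : j = j' := by
      clear h h2
      rcases k with ⟨i, x⟩ | x <;> rcases k' with ⟨i', x'⟩ | x' <;>
        fin_cases j <;> fin_cases j' <;> simp [l] at h1 ⊢ <;> omega
    subst hj
    have hy := hκ k k' j h2
    rcases k with ⟨i, x⟩ | x <;> rcases k' with ⟨i', x'⟩ | x'
    · obtain rfl : x = x' := hy
      obtain rfl : i = i' := by
        clear h h2
        ext
        fin_cases j <;> simp [l] at h1 <;> omega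
      rfl
    · clear h h2
      fin_cases j <;> simp [l] at h1 <;> omega
    · clear h h2
      fin_cases j <;> simp [l] at h1 <;> omega
    · rw [Subtype.ext (show (x : f.ker) = x' from hy)]
  · rintro ⟨k, j⟩ ⟨k', j'⟩ h
    obtain ⟨h1, h2⟩ := hneg _ _ h
    clear h
    rcases k with ⟨i, x⟩ | x <;> rcases k' with ⟨i', x'⟩ | x'
    · clear h2
      fin_cases j <;> fin_cases j' <;> simp [l] at h1 <;> omega
    · clear h2
      fin_cases j <;> fin_cases j' <;> simp [l] at h1 <;> omega
    · clear h2
      fin_cases j <;> fin_cases j' <;> simp [l] at h1 <;> omega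
    · refine hX x x.2 x' x'.2 ?_
      fin_cases j <;> fin_cases j' <;> try (exfalso; simp [l] at h1; omega)
      · exact h2
      · exact h2
      · refine eq_of_two_nsmul_eq_of_odd_card hodd ?_
        rw [smul_neg]
        exact neg_injective h2
  · intro i
    have : ∑ j, l i j = 0 := by
      rcases i with ⟨i, x⟩ | x
      · simp [l, Fin.sum_univ_three]
        ring
      · simp [l, Fin.sum_univ_three]
    simp only [a, sum_add_distrib, ← sum_smul, this, zero_smul, zero_add]
    simp [κ, Fin.sum_univ_three, two_nsmul]

theorem exists_half_of_odd_card {K : Type*} [AddCommGroup K] [Finite K]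
    (hK : Odd (Nat.card K)) :
    ∃ X : Finset K, (∀ x ∈ X, ∀ y ∈ X, x ≠ -y) ∧ Nat.card K = 2 * #X + 1 := by
  classical
  have := Fintype.ofFinite K
  obtain ⟨o⟩ : Nonempty (K ≃ Fin (Fintype.card K)) := ⟨Fintype.equivFin K⟩
  let X : Finset K := {x | o x < o (-x)}
  have hX : ∀ x, x ∈ X ↔ o x < o (-x) := by simp [X]
  refine ⟨X, ?_, ?_⟩
  · rintro x hx y hy rfl
    rw [hX, neg_neg] at hx
    exact lt_asymm hx ((hX y).1 hy)
  · have h0 : ∀ x : K, x = -x ↔ x = 0 := by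
      refine fun x => ⟨fun h => eq_of_two_nsmul_eq_of_odd_card hK ?_, ?_⟩
      · rw [two_nsmul, eq_neg_iff_add_eq_zero.1 h, nsmul_zero]
      · rintro rfl
        rw [neg_zero]
    have hY : (univ : Finset K) = ({0} ∪ X) ∪ X.image (-·) := by
      ext x
      have : x ∈ X.image (-·) ↔ -x ∈ X := by
        simp only [mem_image]
        exact ⟨by rintro ⟨y, hy, rfl⟩; rwa [neg_neg], fun h => ⟨-x, h, neg_neg x⟩⟩
      simp only [mem_univ, mem_union, mem_singleton, this, hX, neg_neg, true_iff]
      obtain h | h | h := lt_trichotomy (o x) (o (-x))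
      · simp [h]
      · simp [(h0 x).1 (o.injective h)]
      · simp [h]
    rw [Nat.card_eq_fintype_card, ← card_univ, hY, card_union_of_disjoint,
      card_union_of_disjoint, card_image_of_injective _ neg_injective, card_singleton]
    · omega
    · simp [hX]
    · rw [disjoint_left]
      intro x hx hx'
      obtain ⟨y, hy, rfl⟩ := mem_image.1 hx'
      rw [hX] at hy
      simp only [mem_union, mem_singleton, hX, neg_neg] at hx
      obtain hx | hx := hx
      · rw [neg_eq_zero.1 hx, neg_zero] at hy
        exact lt_irrefl _ hy
      · exact lt_asymm hx hy

theorem exists_disjoint_sum_eq_zero_of_odd_card_ker {ι Γ : Type*} [Fintype ι] [AddCommGroup Γ]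
    [Fintype Γ] {M : ℕ} (hM : 3 ≤ M) (hM6 : M ≠ 6) (f : Γ →+ ZMod M)
    (hf : Function.Surjective f) (hodd : Odd (Nat.card f.ker)) {n : ι → ℕ}
    (hn : ∀ i, 4 ≤ n i) (hΓ : ∑ i, n i + 6 ≤ Fintype.card Γ) :
    ∃ F : ι → Finset Γ, (∀ i j, i ≠ j → Disjoint (F i) (F j)) ∧
      (∀ i, #(F i) = n i) ∧ ∀ i, ∑ x ∈ F i, x = 0 := by
  classical
  have : NeZero M := ⟨by omega⟩
  have hm := card_ker_mul_card f hf
  rw [ZMod.card] at hm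
  have hℓ : 5 * ∑ i, n i % 2 ≤ ∑ i, n i := by
    rw [mul_sum]
    exact sum_le_sum fun i _ => by have := hn i; omega
  obtain ⟨X, hX, hXcard⟩ := exists_half_of_odd_card hodd
  obtain ⟨q, hq⟩ : ∃ q, q = (M + 1) / 8 := ⟨_, rfl⟩
  let Y : Finset f.ker := if 8 * q + 3 ≤ M then X else ∅
  obtain ⟨a, ha, hneg, hsum⟩ := exists_signed_injective_triples f hf hodd (q := q) (by omega)
    (Y : Set f.ker)
    (fun x hx y hy => by
      simp only [Y] at hx hy
      split_ifs at hx hy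
      · exact hX x hx y hy
      · simp at hx)
    (fun ⟨x, hx⟩ => by
      by_contra h
      simp [Y, h] at hx)
  refine exists_disjoint_sum_eq_zero_of_triples (card_eq_neg_le_two f hodd) ha hneg hsum hn hΓ ?_
  rw [Fintype.card_sum, Fintype.card_prod, Fintype.card_fin, ← Nat.card_eq_fintype_card]
  have hY : Fintype.card (Y : Set f.ker) = #Y := by simp
  rw [hY]
  simp only [Y]
  generalize Nat.card f.ker = h at *
  split_ifs with h3
  · have : M * h ≤ (10 * q + 5) * h := Nat.mul_le_mul_right h (by omega)
    nlinarith
  · have : M * h ≤ (10 * q) * h := Nat.mul_le_mul_right h (by omega)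
    simp only [card_empty]
    nlinarith

theorem exists_addEquiv_pi_zmod (Γ : Type*) [AddCommGroup Γ] [Fintype Γ] :
    ∃ (ι : Type) (_ : Fintype ι) (n : ι → ℕ),
      Fintype.card Γ = ∏ i, n i ∧ Nonempty (Γ ≃+ ∀ i, ZMod (n i)) := by
  classical
  obtain ⟨ι, hι, n, hn, ⟨e⟩⟩ := AddCommGroup.equiv_directSum_zmod_of_finite' Γ
  let e' := e.trans (DirectSum.addEquivProd fun i => ZMod (n i))
  refine ⟨ι, hι, n, ?_, ⟨e'⟩⟩
  rw [← Nat.card_eq_fintype_card, Nat.card_congr e'.toEquiv, Nat.card_pi]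
  simp

theorem exists_surjective_zmod_of_prime_dvd {Γ : Type*} [AddCommGroup Γ] [Fintype Γ] {p : ℕ}
    (hp : p.Prime) (h : p ∣ Fintype.card Γ) :
    ∃ f : Γ →+ ZMod p, Function.Surjective f := by
  obtain ⟨ι, hι, n, hn, ⟨e⟩⟩ := exists_addEquiv_pi_zmod Γ
  rw [hn, hp.prime.dvd_finsetProd_iff] at h
  obtain ⟨i, -, hi⟩ := h
  exact ⟨((ZMod.castHom hi (ZMod p)).toAddMonoidHom.comp (Pi.evalAddMonoidHom _ i)).comp
    e.toAddMonoidHom,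
    ((ZMod.castHom_surjective hi).comp (Function.surjective_eval i)).comp e.surjective⟩

theorem exists_surjective_of_four_dvd {Γ : Type*} [AddCommGroup Γ] [Fintype Γ]
    (h : 4 ∣ Fintype.card Γ) :
    (∃ f : Γ →+ ZMod 4, Function.Surjective f) ∨
      ∃ f : Γ →+ ZMod 2 × ZMod 2, Function.Surjective f := by
  classical
  obtain ⟨ι, hι, n, hn, ⟨e⟩⟩ := exists_addEquiv_pi_zmod Γ
  rw [hn] at h
  by_cases h4 : ∃ i, 4 ∣ n i
  · obtain ⟨i, hi⟩ := h4
    exact .inl ⟨((ZMod.castHom hi (ZMod 4)).toAddMonoidHom.comp (Pi.evalAddMonoidHom _ i)).comp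
      e.toAddMonoidHom,
      ((ZMod.castHom_surjective hi).comp (Function.surjective_eval i)).comp e.surjective⟩
  · right
    push Not at h4
    obtain ⟨i, -, hi⟩ := (Nat.prime_two.prime.dvd_finsetProd_iff _).1
      (dvd_trans (by norm_num : 2 ∣ 4) h)
    obtain ⟨j, hj, hj2⟩ : ∃ j ∈ univ.erase i, 2 ∣ n j := by
      rw [← Nat.prime_two.prime.dvd_finsetProd_iff]
      rw [← mul_prod_erase univ n (mem_univ i)] at h
      by_contra h2
      exact h4 i (Nat.Coprime.dvd_of_dvd_mul_right
        (Nat.Coprime.pow_left 2 ((Nat.Prime.coprime_iff_not_dvd Nat.prime_two).2 h2)) h)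
    have hji : j ≠ i := ne_of_mem_erase hj
    let g : (∀ i, ZMod (n i)) →+ ZMod 2 × ZMod 2 :=
      ((ZMod.castHom hi (ZMod 2)).toAddMonoidHom.comp (Pi.evalAddMonoidHom _ i)).prod
        ((ZMod.castHom hj2 (ZMod 2)).toAddMonoidHom.comp (Pi.evalAddMonoidHom _ j))
    have hg : Function.Surjective g := by
      rintro ⟨x, y⟩
      obtain ⟨x, rfl⟩ := ZMod.castHom_surjective hi x
      obtain ⟨y, rfl⟩ := ZMod.castHom_surjective hj2 y
      refine ⟨Function.update (Function.update 0 i x) j y, ?_⟩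
      simp [g, Function.update_of_ne hji.symm]
    exact ⟨g.comp e.toAddMonoidHom, hg.comp e.surjective⟩

theorem exists_surjective_zmod_two_mul {Γ : Type*} [AddCommGroup Γ] {p : ℕ} (hp : Odd p)
    (f : Γ →+ ZMod 2) (hf : Function.Surjective f) (g : Γ →+ ZMod p)
    (hg : Function.Surjective g) : ∃ k : Γ →+ ZMod (2 * p), Function.Surjective k := by
  have hprod : Function.Surjective (f.prod g) := by
    rintro ⟨x, y⟩
    obtain ⟨x, rfl⟩ := hf x
    obtain ⟨y, rfl⟩ := hg y
    have hp2 : (p : ZMod 2) = 1 := (ZMod.natCast_eq_one_iff_odd).2 hp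
    have h11 : (1 + 1 : ZMod 2) = 0 := by decide
    refine ⟨p • x + (p + 1) • y, Prod.ext ?_ ?_⟩ <;>
      simp [hp2, h11]
  let e := ZMod.chineseRemainder (m := 2) (n := p) (Nat.coprime_two_left.2 hp)
  exact ⟨e.symm.toAddEquiv.toAddMonoidHom.comp (f.prod g), e.symm.surjective.comp hprod⟩

theorem exists_prime_ge_five_dvd {m : ℕ} (hm : 5 ≤ m) (h3 : ¬ 3 ∣ m) (h4 : ¬ 4 ∣ m) :
    ∃ p, p.Prime ∧ 5 ≤ p ∧ p ∣ m := by
  obtain ⟨m', hm', hd, ho⟩ : ∃ m', m' ∣ m ∧ m' ≠ 1 ∧ ¬ 2 ∣ m' := by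
    by_cases h2 : 2 ∣ m
    · obtain ⟨c, rfl⟩ := h2
      exact ⟨c, dvd_mul_left _ _, by omega, by omega⟩
    · exact ⟨m, dvd_rfl, by omega, h2⟩
  have hp := Nat.minFac_prime hd
  refine ⟨_, hp, ?_, (Nat.minFac_dvd m').trans hm'⟩
  by_contra! hlt
  have hdvd := Nat.minFac_dvd m'
  have := hp.two_le
  interval_cases m'.minFac
  · exact ho hdvd
  · exact h3 (hdvd.trans hm')
  · exact absurd hp (by norm_num)

/-- An abelian group of order at least `∑ i, n i + 6`, where all `n i` are at least `4`, contains
pairwise disjoint zero-sum sets of cardinalities `n i`. -/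
theorem exists_disjoint_sum_eq_zero {ι Γ : Type*} [Fintype ι] [AddCommGroup Γ]
    [Fintype Γ] {n : ι → ℕ} (hn : ∀ i, 4 ≤ n i) (hΓ : ∑ i, n i + 6 ≤ Fintype.card Γ) :
    ∃ F : ι → Finset Γ, (∀ i j, i ≠ j → Disjoint (F i) (F j)) ∧
      (∀ i, #(F i) = n i) ∧ ∀ i, ∑ x ∈ F i, x = 0 := by
  by_cases h3 : 3 ∣ Fintype.card Γ
  · obtain ⟨f, hf⟩ := exists_surjective_zmod_of_prime_dvd Nat.prime_three h3
    exact exists_disjoint_sum_eq_zero_of_zmod_three f hf hn hΓ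
  by_cases h4 : 4 ∣ Fintype.card Γ
  · obtain ⟨f, hf⟩ | ⟨f, hf⟩ := exists_surjective_of_four_dvd h4
    · exact exists_disjoint_sum_eq_zero_of_zmod_four f hf hn hΓ
    · exact exists_disjoint_sum_eq_zero_of_zmod_two_prod f hf hn hΓ
  obtain ⟨p, hp, hp5, hpm⟩ := exists_prime_ge_five_dvd (by omega) h3 h4
  have : NeZero p := ⟨hp.ne_zero⟩
  obtain ⟨f, hf⟩ := exists_surjective_zmod_of_prime_dvd hp hpm
  by_cases h2 : 2 ∣ Fintype.card Γ
  · obtain ⟨g, hg⟩ := exists_surjective_zmod_of_prime_dvd Nat.prime_two h2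
    obtain ⟨k, hk⟩ := exists_surjective_zmod_two_mul (hp.odd_of_ne_two (by omega)) g hg f hf
    refine exists_disjoint_sum_eq_zero_of_odd_card_ker (by omega) (by omega) k hk ?_ hn hΓ
    have hm := card_ker_mul_card k hk
    rw [ZMod.card] at hm
    rw [← Nat.not_even_iff_odd, even_iff_two_dvd]
    rintro ⟨c, hc⟩
    exact h4 ⟨c * p, by rw [← hm, hc]; ring⟩
  · refine exists_disjoint_sum_eq_zero_of_odd_card_ker (by omega) (by rintro rfl; norm_num at hp)
      f hf ?_ hn hΓ
    rw [← Nat.not_even_iff_odd, even_iff_two_dvd]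
    exact fun h => h2 (h.trans ⟨_, (card_ker_mul_card f hf).symm⟩)

theorem wReach_symm {V : Type*} {Adj : V → V → Prop} {x y : V} (h : WReach Adj x y) :
    WReach Adj y x :=
  have : Std.Symm fun a b => Adj a b ∨ Adj b a := ⟨fun _ _ => Or.symm⟩
  Std.Symm.symm (r := Relation.ReflTransGen fun a b => Adj a b ∨ Adj b a) _ _ h

/-- The setoid whose classes are the weakly connected components. -/
def wReachSetoid {V : Type*} (Adj : V → V → Prop) : Setoid V where
  r := WReach Adj
  iseqv := ⟨fun _ => .refl, wReach_symm, .trans⟩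

/-- `vertexSum` as a homomorphism in the labeling. -/
def vertexSumHom {V : Type*} (Γ : Type*) [Fintype V] [AddCommGroup Γ] (Adj : V → V → Prop)
    [DecidableRel Adj] : (V → V → Γ) →+ (V → Γ) :=
  AddMonoidHom.mk' (vertexSum Adj) fun ψ ψ' => by
    ext x
    simp only [vertexSum, Pi.add_apply, sum_add_distrib]
    abel

theorem single_sub_single_mem_range_of_adj {V Γ : Type*} [Fintype V] [DecidableEq V]
    [AddCommGroup Γ] {Adj : V → V → Prop} [DecidableRel Adj] {a b : V} (h : Adj a b) (c : Γ) :
    Pi.single a c - Pi.single b c ∈ (vertexSumHom Γ Adj).range := by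
  refine ⟨fun x y => if x = a ∧ y = b then c else 0, funext fun x => ?_⟩
  have h1 : (∑ y with Adj x y, if x = a ∧ y = b then c else 0) =
      (Pi.single a c : V → Γ) x := by
    obtain rfl | hx := eq_or_ne x a
    · simp [h]
    · simp [hx]
  have h2 : (∑ y with Adj y x, if y = a ∧ x = b then c else 0) =
      (Pi.single b c : V → Γ) x := by
    obtain rfl | hx := eq_or_ne x b
    · simp [h]
    · simp [hx]
  exact congrArg₂ (· - ·) h1 h2

theorem single_sub_single_mem_range_of_wReach {V Γ : Type*} [Fintype V] [DecidableEq V]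
    [AddCommGroup Γ] {Adj : V → V → Prop} [DecidableRel Adj] {a b : V} (h : WReach Adj a b)
    (c : Γ) : Pi.single a c - Pi.single b c ∈ (vertexSumHom Γ Adj).range := by
  induction h with
  | refl => simp
  | tail _ h ih =>
    rw [← sub_add_sub_cancel]
    refine add_mem ih ?_
    obtain h | h := h
    · exact single_sub_single_mem_range_of_adj h c
    · rw [← neg_sub]
      exact neg_mem (single_sub_single_mem_range_of_adj h c)

/-- A vertex map with zero sum on every weakly connected component is induced by a labeling. -/
theorem exists_vertexSum_eq {V Γ : Type*} [Fintype V] [AddCommGroup Γ] {Adj : V → V → Prop}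
    [DecidableRel Adj] [DecidableEq (Quotient (wReachSetoid Adj))] {g : V → Γ}
    (hg : ∀ c : Quotient (wReachSetoid Adj), ∑ x with ⟦x⟧ = c, g x = 0) :
    ∃ ψ : V → V → Γ, vertexSum Adj ψ = g := by
  classical
  have := Fintype.ofFinite (Quotient (wReachSetoid Adj))
  let root : V → V := fun x => (⟦x⟧ : Quotient (wReachSetoid Adj)).out
  have h1 : ∑ x, (Pi.single (root x) (g x) : V → Γ) = 0 := by
    rw [← sum_fiberwise univ fun x => (⟦x⟧ : Quotient (wReachSetoid Adj))]
    refine sum_eq_zero fun c _ => ?_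
    have : ∀ x ∈ ({x | ⟦x⟧ = c} : Finset V),
        (Pi.single (root x) (g x) : V → Γ) = AddMonoidHom.single (fun _ => Γ) c.out (g x) := by
      intro x hx
      obtain rfl : ⟦x⟧ = c := by simpa using hx
      rfl
    rw [sum_congr rfl this, ← map_sum, hg, map_zero]
  have h2 : g = ∑ x, (Pi.single x (g x) - Pi.single (root x) (g x)) := by
    rw [sum_sub_distrib, h1, sub_zero, univ_sum_single]
  change g ∈ (vertexSumHom Γ Adj).range
  rw [h2]
  exact sum_mem fun x _ => single_sub_single_mem_range_of_wReach
    (wReach_symm (Quotient.mk_out (s := wReachSetoid Adj) x)) _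

/-- Main corollary: any digraph of order `n` with all weakly connected components of order
at least 4 has a `Γ`-irregular labeling whenever `|Γ| ≥ n + 6`. -/
theorem stmt_13 {V Γ : Type*} [Fintype V] [AddCommGroup Γ] [Fintype Γ]
    (Adj : V → V → Prop) [DecidableRel Adj]
    (hcomp : ∀ x : V, 4 ≤ {y | WReach Adj x y}.ncard)
    (hΓ : Fintype.card V + 6 ≤ Fintype.card Γ) :
    ∃ ψ : V → V → Γ, Function.Injective (vertexSum Adj ψ) := by
  classical
  have := Fintype.ofFinite (Quotient (wReachSetoid Adj))
  let C : Quotient (wReachSetoid Adj) → Finset V := fun c => {x | ⟦x⟧ = c}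
  have hC : ∀ c x, x ∈ C c ↔ ⟦x⟧ = c := by simp [C]
  have hC4 : ∀ c, 4 ≤ #(C c) := by
    intro c
    induction c using Quotient.inductionOn with
    | h x =>
      have : {y | WReach Adj x y} = C ⟦x⟧ := by
        ext y
        rw [mem_coe, hC, Quotient.eq]
        exact ⟨wReach_symm, wReach_symm⟩
      rw [← Set.ncard_coe_finset, ← this]
      exact hcomp x
  have hCsum : ∑ c, #(C c) = Fintype.card V :=
    (card_eq_sum_card_fiberwise fun x _ => mem_univ (⟦x⟧ : Quotient (wReachSetoid Adj))).symm
  obtain ⟨F, hF, hcard, hsum⟩ := exists_disjoint_sum_eq_zero hC4 (hCsum.symm ▸ hΓ)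
  let e : ∀ c, C c ≃ F c := fun c => equivOfCardEq (hcard c).symm
  let g : V → Γ := fun x => e ⟦x⟧ ⟨x, (hC _ x).2 rfl⟩
  have hgF : ∀ x, g x ∈ F (⟦x⟧) := fun x => (e ⟦x⟧ ⟨x, (hC _ x).2 rfl⟩).2
  have hg : ∀ c (x : C c), g x = e c x := by
    rintro c ⟨x, hx⟩
    obtain rfl := (hC c x).1 hx
    rfl
  obtain ⟨ψ, hψ⟩ := exists_vertexSum_eq (Adj := Adj) (g := g) fun c => by
    change ∑ x ∈ C c, g x = 0
    rw [← hsum c, ← sum_coe_sort (C c), ← sum_coe_sort (F c)]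
    exact Fintype.sum_equiv (e c) _ _ (hg c)
  refine ⟨ψ, hψ ▸ fun x y hxy => ?_⟩
  have hxy' : (⟦x⟧ : Quotient (wReachSetoid Adj)) = ⟦y⟧ := by
    by_contra h
    exact Finset.disjoint_left.1 (hF _ _ h) (hgF x) (hxy ▸ hgF y)
  have h1 := hg ⟦y⟧ ⟨x, (hC _ x).2 hxy'⟩
  have h2 := hg ⟦y⟧ ⟨y, (hC _ y).2 rfl⟩
  exact congrArg Subtype.val ((e ⟦y⟧).injective (Subtype.ext (h1.symm.trans (hxy.trans h2))))
end
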